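/- arXiv:2504.11395 — 7 statements merged into one kernel-verified Lean document; each statement's English description precedes it below -/
import Mathlib

section
/- Let ρ(l, ν) (l, ν ≥ 1) be non-negative real numbers such that ∑_{l,ν=1}^∞ ρ(l,ν)/2^{l+ν} < ∞. Then there exist pairwise disjoint subsets A(l, ν) ⊆ ℕ (l, ν ≥ 1), each of positive lower density, such that for all n ∈ A(l, ν) and m ∈ A(k, μ): n ≥ ρ(l, ν), and |n − m| ≥ ρ(l, ν) + ρ(k, μ) whenever n ≠ m. -/
open Filter Topology
open scoped Classical

/-- The lower density of a set of natural numbers: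
`liminf_{N→∞} #(S ∩ {1, …, N}) / N`. -/
noncomputable def lowerDensity (S : Set ℕ) : ℝ :=
  Filter.atTop.liminf fun N : ℕ =>
    ((Finset.Icc 1 N).filter (fun n => n ∈ S)).card / (N : ℝ)

/-- Position of the `(k+1)`-st marked point. -/
def posF (k : ℕ) : ℕ :=
  2 * (k + 1) + 2 * padicValNat 2 (Nat.factorial k) + padicValNat 2 (k + 1)

lemma val_fact_succ (k : ℕ) : padicValNat 2 (Nat.factorial (k + 1)) =
    padicValNat 2 (k + 1) + padicValNat 2 (Nat.factorial k) := by
  have : Fact (Nat.Prime 2) := ⟨Nat.prime_two⟩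
  rw [Nat.factorial_succ, padicValNat.mul (by omega) (Nat.factorial_ne_zero k)]

lemma val_fact_mono : Monotone fun k => padicValNat 2 (Nat.factorial k) := by
  apply monotone_nat_of_le_succ
  intro k
  have := val_fact_succ k
  omega

lemma posF_sep {a b : ℕ} (h : a < b) :
    posF a + (padicValNat 2 (a + 1) + padicValNat 2 (b + 1)) < posF b := by
  have h1 : padicValNat 2 (Nat.factorial (a + 1)) ≤ padicValNat 2 (Nat.factorial b) :=
    val_fact_mono h
  have h2 := val_fact_succ a
  unfold posF
  omega

lemma posF_le (k : ℕ) : posF k ≤ 4 * (k + 1) := by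
  have : Fact (Nat.Prime 2) := ⟨Nat.prime_two⟩
  have h1 := sub_one_mul_padicValNat_factorial (p := 2) (k + 1)
  have h2 := val_fact_succ k
  unfold posF
  omega

lemma posF_inj : Function.Injective posF := by
  intro a b h
  rcases lt_trichotomy a b with hab | hab | hab
  · have := posF_sep hab; omega
  · exact hab
  · have := posF_sep hab; omega

/-- Points of type `d`. -/
def setA (d : ℕ) : Set ℕ := {n | ∃ k, padicValNat 2 (k + 1) = d ∧ posF k = n}

lemma val_aux (d j : ℕ) : padicValNat 2 (2 ^ d * (2 * j + 1)) = d := by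
  have : Fact (Nat.Prime 2) := ⟨Nat.prime_two⟩
  rw [padicValNat.mul (by positivity) (by omega), padicValNat.prime_pow,
    padicValNat.eq_zero_of_not_dvd (by omega)]
  rfl

lemma count_A (d N : ℕ) :
    N / 2 ^ (d + 3) ≤ ((Finset.Icc 1 N).filter (fun n => n ∈ setA d)).card := by
  have hp : 0 < 2 ^ d := by positivity
  have key : ((Finset.range (N / 2 ^ (d + 3))).image
      (fun j => posF (2 ^ d * (2 * j + 1) - 1))) ⊆
      (Finset.Icc 1 N).filter (fun n => n ∈ setA d) := by
    intro n hn
    simp only [Finset.mem_image, Finset.mem_range] at hn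
    obtain ⟨j, hj, rfl⟩ := hn
    have h1 : 0 < 2 ^ d * (2 * j + 1) := by positivity
    have h2 : 2 ^ d * (2 * j + 1) - 1 + 1 = 2 ^ d * (2 * j + 1) := by omega
    simp only [Finset.mem_filter, Finset.mem_Icc]
    refine ⟨⟨by unfold posF; omega, ?_⟩, ⟨_, ?_, rfl⟩⟩
    · have h3 := posF_le (2 ^ d * (2 * j + 1) - 1)
      rw [h2] at h3
      have h4 : (j + 1) * 2 ^ (d + 3) ≤ N :=
        (Nat.le_div_iff_mul_le (by positivity)).1 hj
      rw [pow_add] at h4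
      nlinarith
    · rw [h2]; exact val_aux d j
  calc N / 2 ^ (d + 3) = _ := by
        rw [Finset.card_image_of_injective, Finset.card_range]
        intro a b hab
        have h := posF_inj hab
        have ha : 0 < 2 ^ d * (2 * a + 1) := by positivity
        have hb : 0 < 2 ^ d * (2 * b + 1) := by positivity
        have h' : 2 ^ d * (2 * a + 1) = 2 ^ d * (2 * b + 1) := by
          omega
        have := Nat.eq_of_mul_eq_mul_left hp h'
        omega
    _ ≤ _ := Finset.card_le_card key

lemma dens_A (d : ℕ) : 0 < lowerDensity (setA d) := by
  have hpos : (0 : ℝ) < 1 / 2 ^ (d + 4) := by positivity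
  refine lt_of_lt_of_le hpos ?_
  unfold lowerDensity
  refine le_liminf_of_le ?_ ?_
  · refine IsBoundedUnder.isCoboundedUnder_ge ⟨1, ?_⟩
    rw [eventually_map]
    refine Eventually.of_forall fun N => ?_
    refine div_le_one_of_le₀ ?_ (by positivity)
    have h := Finset.card_filter_le (Finset.Icc 1 N) (fun n => n ∈ setA d)
    rw [Nat.card_Icc] at h
    exact_mod_cast (by simpa using h)
  · filter_upwards [eventually_ge_atTop (2 ^ (d + 4))] with N hN
    have hN0 : 0 < N := lt_of_lt_of_le (by positivity) hN
    have h1 := count_A d N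
    have h2 : N < (N / 2 ^ (d + 3) + 1) * 2 ^ (d + 3) :=
      Nat.lt_mul_of_div_lt (Nat.lt_succ_self _) (by positivity)
    set c := ((Finset.Icc 1 N).filter (fun n => n ∈ setA d)).card with hc
    have h3 : N ≤ c * 2 ^ (d + 4) := by
      have e : 2 ^ (d + 4) = 2 * 2 ^ (d + 3) := by ring
      have h4 : (N / 2 ^ (d + 3)) * 2 ^ (d + 3) ≤ c * 2 ^ (d + 3) :=
        Nat.mul_le_mul_right _ h1
      rw [e] at hN ⊢
      nlinarith
    have h5 : (N : ℝ) ≤ c * 2 ^ (d + 4) := by exact_mod_cast h3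
    rw [div_le_div_iff₀ (by positivity) (by exact_mod_cast hN0)]
    linarith

/-- Lemma of Bonilla–Grosse-Erdmann.  Let `ρ(l, ν)` (`l, ν ≥ 1`) be
non-negative real numbers with `∑_{l,ν≥1} ρ(l,ν)/2^{l+ν} < ∞`.  Then there are pairwise
disjoint sets `A(l, ν) ⊆ ℕ` (`l, ν ≥ 1`) of positive lower density such that for all
`n ∈ A(l, ν)`, `m ∈ A(k, μ)` one has `n ≥ ρ(l, ν)` and
`|n − m| ≥ ρ(l, ν) + ρ(k, μ)` whenever `n ≠ m`. -/
theorem stmt0 (ρ : ℕ → ℕ → ℝ)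
    (hρ : ∀ l ν, 1 ≤ l → 1 ≤ ν → 0 ≤ ρ l ν)
    (hsum : Summable fun p : ℕ × ℕ => ρ (p.1 + 1) (p.2 + 1) / 2 ^ (p.1 + 1 + (p.2 + 1))) :
    ∃ A : ℕ → ℕ → Set ℕ,
      (∀ l ν k μ, 1 ≤ l → 1 ≤ ν → 1 ≤ k → 1 ≤ μ → (l, ν) ≠ (k, μ) →
        Disjoint (A l ν) (A k μ)) ∧
      (∀ l ν, 1 ≤ l → 1 ≤ ν → 0 < lowerDensity (A l ν)) ∧
      (∀ l ν k μ, 1 ≤ l → 1 ≤ ν → 1 ≤ k → 1 ≤ μ →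
        ∀ n ∈ A l ν, ∀ m ∈ A k μ,
          ρ l ν ≤ (n : ℝ) ∧ (n ≠ m → ρ l ν + ρ k μ ≤ |(n : ℝ) - (m : ℝ)|)) := by
  let d : ℕ → ℕ → ℕ := fun l ν => Nat.pair (Nat.pair l ν) ⌈ρ l ν⌉₊
  have hd : ∀ l ν, ρ l ν ≤ (d l ν : ℝ) := fun l ν =>
    (Nat.le_ceil _).trans (by exact_mod_cast Nat.right_le_pair _ _)
  refine ⟨fun l ν => setA (d l ν), ?_, fun l ν _ _ => dens_A _, ?_⟩
  · intro l ν k μ _ _ _ _ hne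
    rw [Set.disjoint_left]
    rintro n ⟨a, ha, rfl⟩ ⟨b, hb, hab⟩
    have := posF_inj hab
    subst this
    have h := ha.symm.trans hb
    simp only [d, Nat.pair_eq_pair] at h
    exact hne (Prod.ext h.1.1 h.1.2)
  · rintro l ν k μ _ _ _ _ n ⟨a, ha, rfl⟩ m ⟨b, hb, rfl⟩
    have h1 := hd l ν
    have h2 := hd k μ
    rw [← ha] at h1
    rw [← hb] at h2
    refine ⟨h1.trans ?_, fun hne => ?_⟩
    · exact_mod_cast (by unfold posF; omega : padicValNat 2 (a + 1) ≤ posF a)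
    · rcases lt_trichotomy a b with hab | hab | hab
      · have h : ((posF a + (padicValNat 2 (a + 1) + padicValNat 2 (b + 1)) : ℕ) : ℝ)
            ≤ posF b := by exact_mod_cast (posF_sep hab).le
        push_cast at h
        rw [abs_sub_comm]
        exact le_trans (by linarith) (le_abs_self _)
      · exact absurd (by rw [hab]) hne
      · have h : ((posF b + (padicValNat 2 (b + 1) + padicValNat 2 (a + 1)) : ℕ) : ℝ)
            ≤ posF a := by exact_mod_cast (posF_sep hab).le
        push_cast at h
        exact le_trans (by linarith) (le_abs_self _)
end

section
/- Let X be a real or complex infinite-dimensional separable Banach space and let A be a closed, densely defined linear operator on X with A^r closed for every positive integer r, admitting a dense subset X_0 of the domain of A and a mapping B : X_0 → X_0 such that A B x = x, ∑_{n=1}^∞ A^n x converges unconditionally, and ∑_{n=1}^∞ B^n x converges unconditionally, for all x ∈ X_0. If A⁻¹ exists and is a bounded linear operator on X, then A⁻¹ is frequently hypercyclic. -/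
open Filter Topology
open scoped Classical

/-- A series `∑_{k=1}^∞ x k` converges unconditionally. -/
def UncondConv {X : Type*} [AddCommGroup X] [Norm X] (x : ℕ → X) : Prop :=
  ∀ ε > (0:ℝ), ∃ N : ℕ, 1 ≤ N ∧ ∀ F : Finset ℕ, (∀ k ∈ F, N < k) → ‖∑ k ∈ F, x k‖ < ε

theorem lowerDensity_pos_aux (S : Set ℕ) (c : ℕ) (hc : 0 < c) (q : ℕ → ℕ)
    (hq : Function.Injective q) (h1 : ∀ t, 1 ≤ q t) (h2 : ∀ t, q t ≤ c * (t + 1))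
    (hS : ∀ t, q t ∈ S) : 0 < lowerDensity S := by
  have hc' : (0:ℝ) < c := by exact_mod_cast hc
  have key : ∀ N : ℕ, N / c ≤ ((Finset.Icc 1 N).filter (fun n => n ∈ S)).card := by
    intro N
    have : ((Finset.range (N / c)).image q) ⊆ (Finset.Icc 1 N).filter (fun n => n ∈ S) := by
      intro n hn
      simp only [Finset.mem_image, Finset.mem_range] at hn
      obtain ⟨t, ht, rfl⟩ := hn
      simp only [Finset.mem_filter, Finset.mem_Icc]
      refine ⟨⟨h1 t, (h2 t).trans ?_⟩, hS t⟩
      calc c * (t + 1) ≤ c * (N / c) := Nat.mul_le_mul_left _ ht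
        _ ≤ N := Nat.mul_div_le N c
    have h := Finset.card_le_card this
    rwa [Finset.card_image_of_injective _ hq, Finset.card_range] at h
  have hle : (1 / (2 * c) : ℝ) ≤ lowerDensity S := by
    unfold lowerDensity
    refine le_liminf_of_le ?_ ?_
    · refine IsCoboundedUnder.of_frequently_le (a := 1) (Eventually.frequently ?_)
      filter_upwards with N
      apply div_le_one_of_le₀ _ (by positivity)
      have := Finset.card_filter_le (Finset.Icc 1 N) (fun n => n ∈ S)
      simp only [Nat.card_Icc, Nat.add_sub_cancel] at this
      exact_mod_cast this
    · filter_upwards [eventually_ge_atTop (2 * c)] with N hN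
      have hN' : (2 * c : ℝ) ≤ N := by exact_mod_cast hN
      have hNpos : (0:ℝ) < N := by linarith
      rw [div_le_div_iff₀ (by positivity) hNpos]
      have h3 : N < c * (N / c + 1) := Nat.lt_mul_div_succ N hc
      have h4 := key N
      have h5 : (N:ℝ) ≤ c * (((Finset.Icc 1 N).filter (fun n => n ∈ S)).card + 1) := by
        have : N ≤ c * (((Finset.Icc 1 N).filter (fun n => n ∈ S)).card + 1) :=
          h3.le.trans (Nat.mul_le_mul_left _ (by omega))
        exact_mod_cast this
      linarith
  exact lt_of_lt_of_le (by positivity) hle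

/-- The separated sets. -/
theorem separated_sets (N : ℕ → ℕ) (hN : ∀ l, 1 ≤ N l) :
    ∃ S : ℕ → Set ℕ, (∀ l, ∀ n ∈ S l, N l ≤ n) ∧
      (∀ l k, ∀ n ∈ S l, ∀ m ∈ S k, (l ≠ k ∨ n ≠ m) →
        ((N l + N k : ℕ) : ℤ) ≤ |(n : ℤ) - m|) ∧
      (∀ l, ∀ R : Set ℕ, S l ⊆ R → 0 < lowerDensity R) := by
  set p : ℕ → ℕ := fun l => l + ∑ i ∈ Finset.range (l + 1), N i with hp
  have hpN : ∀ l, l + N l ≤ p l := by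
    intro l
    have : N l ≤ ∑ i ∈ Finset.range (l + 1), N i :=
      Finset.single_le_sum (f := N) (fun _ _ => Nat.zero_le _) (by simp)
    simp only [hp]; omega
  have hpmono : StrictMono p := by
    apply strictMono_nat_of_lt_succ
    intro l
    simp only [hp, Finset.sum_range_succ _ (l + 1)]; omega
  set G : ℕ → ℕ := fun i => ∑ l ∈ Finset.range (i + 1), if 2 ^ p l ∣ i + 1 then N l else 0 with hG
  set pos : ℕ → ℕ := fun j => 2 * (∑ i ∈ Finset.range j, G i) + G j with hpos
  have hGsum : ∀ j, ∑ i ∈ Finset.range j, G i ≤ 2 * j := by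
    intro j
    have e1 : ∑ i ∈ Finset.range j, G i ≤
        ∑ i ∈ Finset.range j, ∑ l ∈ Finset.range j, if 2 ^ p l ∣ i + 1 then N l else 0 := by
      apply Finset.sum_le_sum
      intro i hi
      apply Finset.sum_le_sum_of_subset
      intro a ha
      simp only [Finset.mem_range] at *
      omega
    have e2 : ∀ l, (∑ i ∈ Finset.range j, if 2 ^ p l ∣ i + 1 then N l else 0)
        = (j / 2 ^ p l) * N l := by
      intro l
      rw [← Finset.sum_filter, Finset.sum_const, smul_eq_mul]
      congr 1
      exact Nat.card_multiples j (2 ^ p l)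
    rw [Finset.sum_comm] at e1
    simp only [e2] at e1
    have e3 : ∀ l, (((j / 2 ^ p l) * N l : ℕ) : ℝ) ≤ j * (1 / 2 : ℝ) ^ l := by
      intro l
      have : (((j / 2 ^ p l : ℕ)) : ℝ) ≤ j / 2 ^ p l := by
        simpa using (Nat.cast_div_le (α := ℝ) (m := j) (n := 2 ^ p l))
      have h2 : (N l : ℝ) ≤ 2 ^ N l := by exact_mod_cast (Nat.lt_two_pow_self).le
      have h3 : (2 : ℝ) ^ (l + N l) ≤ 2 ^ p l := pow_le_pow_right₀ (by norm_num) (hpN l)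
      push_cast
      calc (((j / 2 ^ p l : ℕ)) : ℝ) * N l ≤ (j / 2 ^ p l) * 2 ^ N l := by gcongr
        _ ≤ (j / 2 ^ (l + N l)) * 2 ^ N l := by gcongr
        _ = j * (1 / 2 : ℝ) ^ l := by
          rw [pow_add, one_div, inv_pow]; field_simp
    have e4 : ((∑ l ∈ Finset.range j, (j / 2 ^ p l) * N l : ℕ) : ℝ) ≤ 2 * j := by
      rw [Nat.cast_sum]
      calc _ ≤ ∑ l ∈ Finset.range j, j * (1 / 2 : ℝ) ^ l := Finset.sum_le_sum fun l _ => e3 l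
        _ = j * ∑ l ∈ Finset.range j, (1 / 2 : ℝ) ^ l := by rw [Finset.mul_sum]
        _ ≤ j * 2 := by gcongr; exact sum_geometric_two_le j
        _ = 2 * j := by ring
    exact e1.trans (by exact_mod_cast e4)
  have hposle : ∀ j, pos j ≤ 4 * (j + 1) := by
    intro j
    have := hGsum (j + 1)
    rw [Finset.sum_range_succ] at this
    simp only [hpos]; omega
  have hsep : ∀ i j, i < j → pos i + (G i + G j) ≤ pos j := by
    intro i j hij
    have : ∑ t ∈ Finset.range (i + 1), G t ≤ ∑ t ∈ Finset.range j, G t := by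
      apply Finset.sum_le_sum_of_subset
      intro a ha
      simp only [Finset.mem_range] at *
      omega
    rw [Finset.sum_range_succ] at this
    simp only [hpos]; omega
  have hsep' : ∀ i j, i ≠ j → ((G i + G j : ℕ) : ℤ) ≤ |(pos i : ℤ) - pos j| := by
    intro i j hij
    rcases lt_or_gt_of_ne hij with h | h
    · have := hsep i j h
      rw [abs_sub_comm]
      refine le_trans ?_ (le_abs_self _)
      omega
    · have := hsep j i h
      refine le_trans ?_ (le_abs_self _)
      omega
  set I : ℕ → Set ℕ := fun l => {j | ∃ t, j + 1 = 2 ^ p l * (2 * t + 1)} with hI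
  have hGI : ∀ l, ∀ j ∈ I l, N l ≤ G j := by
    rintro l j ⟨t, ht⟩
    have hl : l ∈ Finset.range (j + 1) := by
      simp only [Finset.mem_range]
      have a1 : l < 2 ^ l := Nat.lt_two_pow_self
      have a2 : 2 ^ l ≤ 2 ^ p l := Nat.pow_le_pow_right (by norm_num) (by have := hpN l; omega)
      have a3 : 2 ^ p l ≤ 2 ^ p l * (2 * t + 1) := Nat.le_mul_of_pos_right _ (by omega)
      omega
    have := Finset.single_le_sum (f := fun l => if 2 ^ p l ∣ j + 1 then N l else 0)
      (fun _ _ => Nat.zero_le _) hl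
    simp only [ht, dvd_mul_right, if_true] at this
    simp only [hG, ht]
    exact this
  have hIdisj : ∀ l k, l < k → ∀ j ∈ I l, j ∉ I k := by
    rintro l k hlk j ⟨t, ht⟩ ⟨s, hs⟩
    have h := hpmono hlk
    obtain ⟨d, hd⟩ := Nat.exists_eq_add_of_lt h
    rw [hs, hd, show p l + d + 1 = p l + (d + 1) by ring, pow_add, mul_assoc] at ht
    have := Nat.eq_of_mul_eq_mul_left (by positivity) ht
    rw [pow_succ, mul_comm (2 ^ d) 2, mul_assoc] at this
    omega
  refine ⟨fun l => pos '' I l, ?_, ?_, ?_⟩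
  · rintro l _ ⟨j, hj, rfl⟩
    have := hGI l j hj
    simp only [hpos]; omega
  · rintro l k _ ⟨i, hi, rfl⟩ _ ⟨j, hj, rfl⟩ hne
    have hij : i ≠ j := by
      rintro rfl
      rcases hne with h | h
      · rcases lt_or_gt_of_ne h with h | h
        · exact hIdisj l k h i hi hj
        · exact hIdisj k l h i hj hi
      · exact h rfl
    have := hsep' i j hij
    have a := hGI l i hi
    have b := hGI k j hj
    refine le_trans ?_ this
    exact_mod_cast add_le_add a b
  · intro l R hR
    have hJ : ∀ t, 2 ^ p l * (2 * t + 1) - 1 + 1 = 2 ^ p l * (2 * t + 1) := by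
      intro t
      have : 0 < 2 ^ p l * (2 * t + 1) := by positivity
      omega
    have hJI : ∀ t, 2 ^ p l * (2 * t + 1) - 1 ∈ I l := fun t => ⟨t, hJ t⟩
    have hp1 : ∀ t, 1 ≤ pos (2 ^ p l * (2 * t + 1) - 1) := by
      intro t
      have := hGI l _ (hJI t)
      have := hN l
      simp only [hpos]; omega
    refine lowerDensity_pos_aux R (8 * 2 ^ p l) (by positivity)
      (fun t => pos (2 ^ p l * (2 * t + 1) - 1)) ?_ hp1 ?_ ?_
    · intro s t hst
      by_contra hne
      have hne' : 2 ^ p l * (2 * s + 1) - 1 ≠ 2 ^ p l * (2 * t + 1) - 1 := by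
        intro h
        have h' : 2 ^ p l * (2 * s + 1) = 2 ^ p l * (2 * t + 1) := by
          rw [← hJ s, ← hJ t, h]
        have := Nat.eq_of_mul_eq_mul_left (by positivity) h'
        omega
      have h := hsep' _ _ hne'
      have a := hGI l _ (hJI s)
      have b := hN l
      simp only at hst
      rw [hst, sub_self, abs_zero] at h
      omega
    · intro t
      have := hposle (2 ^ p l * (2 * t + 1) - 1)
      rw [hJ] at this
      refine this.trans ?_
      nlinarith [Nat.zero_le (2 ^ p l)]
    · intro t
      exact hR ⟨_, hJI t, rfl⟩

theorem UncondConv.summable_aux {X : Type*} [NormedAddCommGroup X] [CompleteSpace X] {x : ℕ → X}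
    (h : UncondConv x) : Summable x := by
  rw [summable_iff_vanishing_norm]
  intro ε hε
  obtain ⟨N, -, hN⟩ := h ε hε
  refine ⟨Finset.range (N + 1), fun t ht => hN t ?_⟩
  intro k hk
  have := Finset.disjoint_left.1 ht hk
  simpa using this

theorem tail_aux {X : Type*} [NormedAddCommGroup X] [CompleteSpace X] {g : ℤ → X}
    (h : Summable g) {ε : ℝ} (hε : 0 < ε) : ∃ N : ℕ, ∀ M : ℕ, N ≤ M → ∀ E : Set ℤ,
      (∀ m ∈ E, (M : ℤ) ≤ |m|) → ‖∑' m, E.indicator g m‖ ≤ ε := by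
  obtain ⟨s, hs⟩ := h.tsum_vanishing (Metric.ball_mem_nhds (0 : X) hε)
  refine ⟨(∑ m ∈ s, m.natAbs) + 1, fun M hM E hE => ?_⟩
  have hd : Disjoint E (s : Set ℤ) := by
    rw [Set.disjoint_left]
    intro m hm hms
    have h1 := hE m hm
    have h2 := Finset.single_le_sum (f := fun m : ℤ => m.natAbs) (fun _ _ => Nat.zero_le _) hms
    rw [Int.abs_eq_natAbs] at h1
    omega
  have := hs E hd
  rw [tsum_subtype, mem_ball_zero_iff] at this
  exact this.le

/-- Frequent hypercyclicity from bilateral summable orbits. -/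
theorem fhc_aux {𝕜 X : Type*} [RCLike 𝕜] [NormedAddCommGroup X] [NormedSpace 𝕜 X]
    [CompleteSpace X] (T : X →L[𝕜] X) (g : ℕ → ℤ → X) (hg : ∀ j, Summable (g j))
    (hT : ∀ j m, T (g j (m + 1)) = g j m)
    (hd : ∀ U : Set X, IsOpen U → U.Nonempty → ∃ l, Metric.ball (g l 0) (3 * (1 / 2 : ℝ) ^ l) ⊆ U) :
    ∃ x : X, ∀ U : Set X, IsOpen U → U.Nonempty → 0 < lowerDensity {n : ℕ | T^[n] x ∈ U} := by
  have hTn : ∀ (n : ℕ) j m, (T ^ n) (g j m) = g j (m - n) := by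
    intro n
    induction n with
    | zero => intro j m; simp
    | succ n ih =>
      intro j m
      rw [pow_succ, ContinuousLinearMap.mul_apply]
      have := hT j (m - 1)
      rw [sub_add_cancel] at this
      rw [this, ih]
      push_cast
      congr 1
      ring
  choose N0 hN0 using fun j l => tail_aux (hg j) (ε := (1 / 4 : ℝ) ^ l) (by positivity)
  set N : ℕ → ℕ := fun l => 1 + ∑ j ∈ Finset.range (l + 1), N0 j l with hNdef
  have hN1 : ∀ l, 1 ≤ N l := fun l => by simp [hNdef]
  have htail : ∀ l j, j ≤ l → ∀ E : Set ℤ, (∀ m ∈ E, (N l : ℤ) ≤ |m|) →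
      ‖∑' m, E.indicator (g j) m‖ ≤ (1 / 4 : ℝ) ^ l := by
    intro l j hj E hE
    refine hN0 j l (N l) ?_ E hE
    have := Finset.single_le_sum (f := fun j => N0 j l) (s := Finset.range (l + 1))
      (fun _ _ => Nat.zero_le _) (Finset.mem_range.2 (Nat.lt_succ_of_le hj))
    simp only [hNdef]
    omega
  obtain ⟨S, hS1, hS2, hS3⟩ := separated_sets N hN1
  set S' : ℕ → Set ℤ := fun j => (fun n : ℕ => (n : ℤ)) '' S j with hS'
  set w : ℕ → X := fun j => ∑' m, (S' j).indicator (g j) m with hw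
  have hwn : ∀ j, ‖w j‖ ≤ (1 / 4 : ℝ) ^ j := by
    intro j
    apply htail j j le_rfl
    rintro _ ⟨n, hn, rfl⟩
    have := hS1 j n hn
    simp only [Nat.abs_cast]
    exact_mod_cast this
  have hwsum : Summable w :=
    Summable.of_norm_bounded (summable_geometric_of_lt_one (by norm_num) (by norm_num)) hwn
  have hTw : ∀ (n : ℕ) j, (T ^ n) (w j) = ∑' m, {m : ℤ | m + n ∈ S' j}.indicator (g j) m := by
    intro n j
    simp only [hw]
    rw [ContinuousLinearMap.map_tsum _ ((hg j).indicator _),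
      ← (Equiv.addRight (n : ℤ)).tsum_eq]
    congr 1
    ext m
    by_cases hm : m + n ∈ S' j
    · simp [Set.indicator, hm, hTn]
    · simp [Set.indicator, hm]
  have hest : ∀ l, ∀ n ∈ S l, ∀ j, ‖(T ^ n) (w j) - (if j = l then g l 0 else 0)‖ ≤
      (1 / 2 : ℝ) ^ l * (1 / 2 : ℝ) ^ j := by
    intro l n hn j
    set E : Set ℤ := {m : ℤ | m + n ∈ S' j} \ {0} with hE
    have hEq : (T ^ n) (w j) - (if j = l then g l 0 else 0) = ∑' m, E.indicator (g j) m := by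
      rw [hTw]
      by_cases hjl : j = l
      · subst hjl
        have hmem : (0 : ℤ) ∈ {m : ℤ | m + n ∈ S' j} := ⟨n, hn, by simp⟩
        rw [((hg j).indicator _).tsum_eq_add_tsum_ite 0]
        simp only [if_true, Set.indicator_of_mem hmem, add_sub_cancel_left]
        congr 1
        ext m
        by_cases hm : m = 0
        · simp [hE, hm]
        · simp [hE, hm, Set.indicator]
      · rw [if_neg hjl, sub_zero]
        have : E = {m : ℤ | m + n ∈ S' j} := by
          rw [hE, Set.diff_singleton_eq_self]
          rintro ⟨k, hk, hkn⟩
          have hkn' : k = n := by simpa using hkn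
          subst hkn'
          have := hS2 j l k hk k hn (Or.inl hjl)
          rw [sub_self, abs_zero] at this
          have := hN1 j
          omega
        rw [this]
    have hEm : ∀ m ∈ E, ((N l + N j : ℕ) : ℤ) ≤ |m| := by
      rintro m ⟨⟨k, hk, hkn⟩, hm0⟩
      simp only at hkn
      have hm0' : m ≠ 0 := hm0
      have := hS2 j l k hk n hn (Or.inr (by rintro rfl; apply hm0'; omega))
      rw [hkn, add_sub_cancel_right] at this
      rwa [add_comm]
    rw [hEq]
    have h14 : ∀ a b : ℕ, a ≤ b → (1 / 4 : ℝ) ^ b ≤ (1 / 2 : ℝ) ^ a * (1 / 2 : ℝ) ^ b := by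
      intro a b hab
      rw [show (1 / 4 : ℝ) = 1 / 2 * (1 / 2) by norm_num, mul_pow]
      gcongr ?_ * _
      exact pow_le_pow_of_le_one (by norm_num) (by norm_num) hab
    rcases le_total j l with h | h
    · refine (htail l j h E fun m hm => ?_).trans ?_
      · have := hEm m hm; omega
      · rw [mul_comm]; exact h14 j l h
    · refine (htail j j le_rfl E fun m hm => ?_).trans (h14 l j h)
      have := hEm m hm; omega
  have hit : ∀ (n : ℕ) (x : X), (⇑T)^[n] x = (T ^ n) x := by
    intro n
    induction n with
    | zero => intro x; simp
    | succ n ih =>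
      intro x
      rw [Function.iterate_succ_apply, ih, pow_succ]
      rfl
  refine ⟨∑' j, w j, fun U hU hUne => ?_⟩
  obtain ⟨l, hl⟩ := hd U hU hUne
  apply hS3 l
  intro n hn
  apply hl
  have hpow : (⇑T)^[n] (∑' j, w j) = (T ^ n) (∑' j, w j) := by
    rw [hit]
  rw [mem_ball_iff_norm, hpow, ContinuousLinearMap.map_tsum _ hwsum]
  have hsA : HasSum (fun j => (T ^ n) (w j)) (∑' j, (T ^ n) (w j)) :=
    (hwsum.mapL (T ^ n)).hasSum
  have hsB : HasSum (fun j => if j = l then g l 0 else 0) (g l 0) := hasSum_ite_eq l (g l 0)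
  have hsum := hsA.sub hsB
  have hgeo : HasSum (fun j : ℕ => (1 / 2 : ℝ) ^ l * (1 / 2 : ℝ) ^ j) ((1 / 2 : ℝ) ^ l * 2) :=
    hasSum_geometric_two.mul_left _
  have hb := hsum.norm_le_of_bounded hgeo (hest l n hn)
  have : (0 : ℝ) < (1 / 2 : ℝ) ^ l := by positivity
  linarith

/-- Let `X` be a real or complex infinite-dimensional separable Banach
space and `A` a closed, densely defined linear operator on `X` (modelled as a total map
linear on the submodule `D`, each power `A^r` with its natural domain being closed),
satisfying the Frequent Hypercyclicity Criterion: a dense subset `X₀` of the domain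
(contained in `D(A^∞)`) with a map `B : X₀ → X₀` such that `A B x = x` and `∑ A^n x`,
`∑ B^n x` converge unconditionally for `x ∈ X₀`.  If `A⁻¹` exists as a bounded linear
operator on `X`, then `A⁻¹` is frequently hypercyclic. -/
theorem stmt3 {𝕜 X : Type*} [RCLike 𝕜] [NormedAddCommGroup X] [NormedSpace 𝕜 X]
    [CompleteSpace X] [TopologicalSpace.SeparableSpace X]
    (hinfdim : ¬ FiniteDimensional 𝕜 X)
    (D : Submodule 𝕜 X) (A : X → X)
    (hdense : Dense (D : Set X))
    (hadd : ∀ x ∈ D, ∀ y ∈ D, A (x + y) = A x + A y)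
    (hsmul : ∀ c : 𝕜, ∀ x ∈ D, A (c • x) = c • A x)
    (hclosed : ∀ r : ℕ, 1 ≤ r → ∀ (u : ℕ → X) (a b : X),
      (∀ j, ∀ i < r, A^[i] (u j) ∈ D) →
      Tendsto u atTop (𝓝 a) → Tendsto (fun j => A^[r] (u j)) atTop (𝓝 b) →
      (∀ i < r, A^[i] a ∈ D) ∧ A^[r] a = b)
    (X₀ : Set X) (hX₀D : X₀ ⊆ D) (hX₀dense : Dense X₀)
    (hX₀inf : ∀ x ∈ X₀, ∀ n : ℕ, A^[n] x ∈ D)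
    (B : X → X) (hB : ∀ x ∈ X₀, B x ∈ X₀)
    (h1 : ∀ x ∈ X₀, A (B x) = x)
    (h2 : ∀ x ∈ X₀, UncondConv fun n => A^[n] x)
    (h3 : ∀ x ∈ X₀, UncondConv fun n => B^[n] x)
    -- `A⁻¹` exists and is a bounded linear operator on `X`
    (Ainv : X →L[𝕜] X)
    (hAinv₁ : ∀ x ∈ D, Ainv (A x) = x)
    (hAinv₂ : ∀ y : X, Ainv y ∈ D ∧ A (Ainv y) = y) :
    -- conclusion: `A⁻¹` is frequently hypercyclic
    ∃ x : X, ∀ U : Set X, IsOpen U → U.Nonempty →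
      0 < lowerDensity {n : ℕ | (⇑Ainv)^[n] x ∈ U} := by
  have hBT : ∀ x ∈ X₀, Ainv x = B x := fun x hx => by
    have := hAinv₁ (B x) (hX₀D (hB x hx))
    rwa [h1 x hx] at this
  have hBn : ∀ n, ∀ x ∈ X₀, Ainv^[n] x = B^[n] x := by
    intro n
    induction n with
    | zero => intro x _; rfl
    | succ n ih =>
      intro x hx
      rw [Function.iterate_succ_apply, Function.iterate_succ_apply, hBT x hx, ih _ (hB x hx)]
  obtain ⟨t, htX, htc, htd⟩ := hX₀dense.exists_countable_dense_subset
  have htne : t.Nonempty := htd.nonempty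
  obtain ⟨d, rfl⟩ := htc.exists_eq_range htne
  have hdX : ∀ i, d i ∈ X₀ := fun i => htX ⟨i, rfl⟩
  let o : X → ℤ → X := fun x m => Int.casesOn m (fun n => A^[n] x) (fun n => Ainv^[n + 1] x)
  have hosum : ∀ x ∈ X₀, Summable (o x) := by
    intro x hx
    refine Summable.of_nat_of_neg_add_one (h2 x hx).summable_aux ?_
    have h := (summable_nat_add_iff 1).2 (h3 x hx).summable_aux
    refine h.congr fun n => ?_
    rw [← hBn (n + 1) x hx, ← Int.negSucc_eq]
  have hoT : ∀ x ∈ X₀, ∀ m, Ainv (o x (m + 1)) = o x m := by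
    intro x hx m
    rcases m with n | n
    · change Ainv (A^[n + 1] x) = A^[n] x
      rw [Function.iterate_succ_apply']
      exact hAinv₁ _ (hX₀inf x hx n)
    · rcases n with _ | n
      · rfl
      · change Ainv (Ainv^[n + 1] x) = Ainv^[n + 1 + 1] x
        rw [Function.iterate_succ_apply' _ (n + 1)]
  refine fhc_aux Ainv (fun l => o (d (Nat.unpair l).1)) (fun j => hosum _ (hdX _))
    (fun j m => hoT _ (hdX _) m) ?_
  intro U hU hUne
  obtain ⟨_, hy, ⟨i, rfl⟩⟩ := htd.inter_open_nonempty U hU hUne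
  obtain ⟨r, hr, hrU⟩ := Metric.isOpen_iff.1 hU _ hy
  obtain ⟨b, hb⟩ := exists_pow_lt_of_lt_one (show (0 : ℝ) < r / 3 by positivity)
    (show (1 / 2 : ℝ) < 1 by norm_num)
  refine ⟨Nat.pair i b, ?_⟩
  have hz : o (d (Nat.unpair (Nat.pair i b)).1) 0 = d i := by
    rw [Nat.unpair_pair]; rfl
  simp only [hz]
  refine (Metric.ball_subset_ball ?_).trans hrU
  have : (1 / 2 : ℝ) ^ Nat.pair i b ≤ (1 / 2 : ℝ) ^ b :=
    pow_le_pow_of_le_one (by norm_num) (by norm_num) (Nat.right_le_pair i b)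
  linarith
end

section
/- Let X be a real or complex infinite-dimensional separable Banach space and let A be a closed, densely defined linear operator on X with A^r closed for every positive integer r, admitting a dense subset X_0 of the domain of A with X_0 ⊆ D^∞(A) := ⋂_{n≥0} D(A^n) and a mapping B : X_0 → X_0 such that A B x = x, ∑_{n=1}^∞ A^n x converges unconditionally, and ∑_{n=1}^∞ B^n x converges unconditionally, for all x ∈ X_0. Then for every n ∈ ℕ the power A^n is frequently hypercyclic. -/
open Filter Topology
open scoped Classical

/-- A (possibly unbounded) operator `T` with domain `D` is frequently hypercyclic. -/
def FreqHypercyclic {X : Type*} [TopologicalSpace X] (D : Set X) (T : X → X) : Prop :=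
  ∃ f ∈ D, (∀ n : ℕ, 1 ≤ n → T^[n] f ∈ D) ∧
    ∀ U : Set X, IsOpen U → U.Nonempty → 0 < lowerDensity {n : ℕ | T^[n] f ∈ U}

/-- Strictly increasing positions with gaps controlled by the 2-adic valuation. -/
def bpos (k : ℕ) : ℕ := k + padicValNat 2 (k.factorial)

lemma bpos_succ (k : ℕ) : bpos (k+1) = bpos k + (1 + padicValNat 2 (k+1)) := by
  unfold bpos
  rw [Nat.factorial_succ, padicValNat.mul (by omega) (Nat.factorial_ne_zero k)]
  omega

lemma bpos_mono : Monotone bpos :=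
  monotone_nat_of_le_succ fun k => by rw [bpos_succ]; omega

lemma bpos_le (k : ℕ) : bpos k ≤ 2 * k := by
  have := sub_one_mul_padicValNat_factorial (p := 2) k
  unfold bpos
  have h2 : padicValNat 2 (k.factorial) ≤ k := by
    have : (2-1) * padicValNat 2 (k.factorial) ≤ k := by rw [this]; omega
    simpa using this
  omega

lemma le_bpos (k : ℕ) : k ≤ bpos k := by unfold bpos; omega

/-- positions -/
def apos (k : ℕ) : ℕ := bpos k + bpos (k - 1)

lemma apos_gap {k l : ℕ} (hk : 1 ≤ k) (h : k < l) :
    apos k + padicValNat 2 k + padicValNat 2 l < apos l := by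
  obtain ⟨k, rfl⟩ : ∃ j, k = j + 1 := ⟨k - 1, by omega⟩
  obtain ⟨l, rfl⟩ : ∃ j, l = j + 1 := ⟨l - 1, by omega⟩
  have h1 := bpos_succ k
  have h2 := bpos_succ l
  have h3 : bpos (k+1) ≤ bpos l := bpos_mono (by omega)
  unfold apos
  simp only [Nat.add_sub_cancel]
  omega

lemma combin (N : ℕ → ℕ) : ∃ (E : Set ℕ) (lab : ℕ → ℕ),
    (∀ e ∈ E, N (lab e) < e) ∧
    (∀ e ∈ E, ∀ e' ∈ E, e ≠ e' → (N (lab e) : ℤ) < |(e:ℤ) - e'|) ∧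
    (∀ M, ∃ e ∈ E, M < e) ∧
    (∀ p, ∀ S : Set ℕ, (∀ e ∈ E, lab e = p → e ∈ S) → 0 < lowerDensity S) := by
  let σ : ℕ → ℕ := fun p => ∑ i ∈ Finset.range (p+1), (N i + 1)
  have hσm : StrictMono σ := strictMono_nat_of_lt_succ fun p => by
    simp only [σ]; rw [Finset.sum_range_succ _ (p+1)]; omega
  have hσN : ∀ p, N p ≤ σ p := fun p => by
    simp only [σ]; rw [Finset.sum_range_succ]; omega
  let E : Set ℕ := {e | ∃ k p, 1 ≤ k ∧ padicValNat 2 k = σ p ∧ e = apos k}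
  have hinj : ∀ k l, 1 ≤ k → 1 ≤ l → apos k = apos l → k = l := by
    intro k l hk hl h
    rcases lt_trichotomy k l with h' | h' | h'
    · have := apos_gap hk h'; omega
    · exact h'
    · have := apos_gap hl h'; omega
  have hlab : ∀ e, ∃ p, ∀ k q, 1 ≤ k → padicValNat 2 k = σ q → e = apos k → p = q := by
    intro e
    by_cases he : e ∈ E
    · obtain ⟨k, p, hk, hp, rfl⟩ := he
      refine ⟨p, fun l q hl hq h => ?_⟩
      have := hinj _ _ hk hl h
      subst this
      exact hσm.injective (hp.symm.trans hq)
    · exact ⟨0, fun k q h1 h2 h3 => (he ⟨k, q, h1, h2, h3⟩).elim⟩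
  choose lab hlab using hlab
  have hval : ∀ s j : ℕ, padicValNat 2 (2^s*(2*j+1)) = s := by
    intro s j
    rw [padicValNat.mul (by positivity) (by omega), padicValNat.prime_pow,
      padicValNat.eq_zero_of_not_dvd (by omega)]
    simp
  have hmem : ∀ p j : ℕ, apos (2^(σ p)*(2*j+1)) ∈ E ∧ lab (apos (2^(σ p)*(2*j+1))) = p := by
    intro p j
    have h1 : 1 ≤ 2^(σ p)*(2*j+1) := Nat.succ_le_of_lt (by positivity)
    exact ⟨⟨_, p, h1, hval _ _, rfl⟩, hlab _ _ p h1 (hval _ _) rfl⟩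
  have hge : ∀ k, k ≤ apos k := fun k => by
    have := le_bpos k; unfold apos; omega
  refine ⟨E, lab, ?_, ?_, ?_, ?_⟩
  · rintro e ⟨k, p, hk, hp, rfl⟩
    rw [hlab _ k p hk hp rfl]
    obtain ⟨k, rfl⟩ : ∃ j, k = j + 1 := ⟨k - 1, by omega⟩
    have h1 := bpos_succ k
    have h2 := hσN p
    unfold apos
    omega
  · rintro e ⟨k, p, hk, hp, rfl⟩ e' ⟨l, q, hl, hq, rfl⟩ hne
    rw [hlab _ k p hk hp rfl]
    have h2 := hσN p
    rcases lt_trichotomy k l with h' | h' | h'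
    · have := apos_gap hk h'
      rw [lt_abs]; right; omega
    · subst h'; exact (hne rfl).elim
    · have := apos_gap hl h'
      rw [lt_abs]; left; omega
  · intro M
    refine ⟨_, (hmem 0 M).1, ?_⟩
    refine lt_of_lt_of_le ?_ (hge _)
    have : 1 ≤ 2^(σ 0) := Nat.one_le_two_pow
    nlinarith
  · intro p S hS
    set Q := 8 * 2^(σ p) with hQ
    have hQ0 : 0 < Q := by positivity
    have hQR : (0:ℝ) < Q := by exact_mod_cast hQ0
    have key : ∀ M : ℕ, M / Q ≤ ((Finset.Icc 1 M).filter (fun n => n ∈ S)).card := by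
      intro M
      have hi : Set.InjOn (fun j => apos (2^(σ p)*(2*j+1))) (Finset.range (M/Q) : Set ℕ) := by
        intro i _ j _ h
        have := hinj _ _ (Nat.succ_le_of_lt (by positivity)) (Nat.succ_le_of_lt (by positivity)) h
        have := Nat.eq_of_mul_eq_mul_left (by positivity) this
        omega
      rw [← Finset.card_range (M/Q), ← Finset.card_image_of_injOn hi]
      apply Finset.card_le_card
      intro e he
      simp only [Finset.mem_image, Finset.mem_range] at he
      obtain ⟨j, hj, rfl⟩ := he
      simp only [Finset.mem_filter, Finset.mem_Icc]
      have h1 : 1 ≤ 2^(σ p)*(2*j+1) := Nat.succ_le_of_lt (by positivity)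
      refine ⟨⟨h1.trans (hge _), ?_⟩, hS _ (hmem p j).1 (hmem p j).2⟩
      have h2 := bpos_le (2^(σ p)*(2*j+1))
      have h3 := bpos_mono (Nat.sub_le (2^(σ p)*(2*j+1)) 1)
      have h4 : (j+1) * Q ≤ M := (Nat.mul_le_mul_right Q hj).trans (Nat.div_mul_le_self M Q)
      unfold apos
      have h5 : (j+1) * Q = 4 * (2^(σ p)*(2*j+1)) + 4 * 2^(σ p) := by rw [hQ]; ring
      omega
    unfold lowerDensity
    have hc : (0:ℝ) < 1 / (2 * Q) := by positivity
    refine lt_of_lt_of_le hc ?_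
    apply le_liminf_of_le
    · apply IsBoundedUnder.isCoboundedUnder_ge
      refine ⟨1, ?_⟩
      rw [eventually_map]
      refine Eventually.of_forall fun M => ?_
      apply div_le_one_of_le₀ _ (by positivity)
      have := Finset.card_filter_le (Finset.Icc 1 M) (fun n => n ∈ S)
      rw [Nat.card_Icc] at this
      exact_mod_cast this
    · filter_upwards [eventually_ge_atTop Q] with M hM
      have hM0 : (0:ℝ) < M := by exact_mod_cast hQ0.trans_le hM
      rw [div_le_div_iff₀ (by positivity) hM0]
      have h1 := key M
      have h2 : 1 ≤ M / Q := (Nat.one_le_div_iff hQ0).2 hM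
      have h3 := Nat.div_add_mod M Q
      have h4 := Nat.mod_lt M hQ0
      have h5 : M ≤ 2 * (M/Q) * Q := by nlinarith
      have h6 : M ≤ ((Finset.Icc 1 M).filter (fun n => n ∈ S)).card * (2 * Q) := by nlinarith
      rw [one_mul]
      exact_mod_cast h6

/-- The estimate lemma. -/
lemma estimate {X : Type*} [NormedAddCommGroup X] (V : ℕ → ℤ → X) (N : ℕ → ℕ)
    (hV : ∀ p K, ∀ F : Finset ℤ, (∀ i ∈ F, (N p : ℤ) < |i| ∧ (N K : ℤ) < |i|) →
      ‖∑ i ∈ F, V p i‖ ≤ (1/2:ℝ)^p * (1/2)^K)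
    (E : Set ℕ) (lab : ℕ → ℕ) (m K : ℕ) (F : Finset ℕ)
    (hF : ∀ e ∈ F, e ∈ E → (N (lab e) : ℤ) < |(e:ℤ) - m| ∧ (N K : ℤ) < |(e:ℤ) - m|) :
    ‖∑ e ∈ F, (if e ∈ E then V (lab e) ((e:ℤ) - m) else 0)‖ ≤ 2 * (1/2:ℝ)^K := by
  rw [← Finset.sum_filter]
  set G := F.filter (fun e => e ∈ E) with hG
  rw [← Finset.sum_fiberwise_of_maps_to (g := lab) (t := G.image lab)
    (fun e he => Finset.mem_image_of_mem _ he)]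
  calc _ ≤ ∑ p ∈ G.image lab, (1/2:ℝ)^p * (1/2)^K := by
        refine norm_sum_le_of_le _ fun p _ => ?_
        have : ∑ e ∈ G with lab e = p, V (lab e) ((e:ℤ) - m)
            = ∑ i ∈ (G.filter (fun e => lab e = p)).image (fun e : ℕ => (e:ℤ) - m), V p i := by
          rw [Finset.sum_image]
          · refine Finset.sum_congr rfl fun e he => ?_
            rw [(Finset.mem_filter.1 he).2]
          · intro a _ b _ h
            simp only at h
            omega
        rw [this]
        apply hV
        intro i hi
        obtain ⟨e, he, rfl⟩ := Finset.mem_image.1 hi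
        obtain ⟨heG, rfl⟩ := Finset.mem_filter.1 he
        have hh := Finset.mem_filter.1 heG
        exact hF e hh.1 hh.2
    _ = (∑ p ∈ G.image lab, (1/2:ℝ)^p) * (1/2)^K := by rw [Finset.sum_mul]
    _ ≤ 2 * (1/2)^K := by
        gcongr
        have := summable_geometric_two.sum_le_tsum (G.image lab) (fun i _ => by positivity)
        rwa [tsum_geometric_two] at this

lemma summable_aux {X : Type*} [NormedAddCommGroup X] [CompleteSpace X]
    (V : ℕ → ℤ → X) (N : ℕ → ℕ)
    (hV : ∀ p K, ∀ F : Finset ℤ, (∀ i ∈ F, (N p : ℤ) < |i| ∧ (N K : ℤ) < |i|) →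
      ‖∑ i ∈ F, V p i‖ ≤ (1/2:ℝ)^p * (1/2)^K)
    (E : Set ℕ) (lab : ℕ → ℕ) (m : ℕ)
    (hm : ∀ e ∈ E, e ≠ m → (N (lab e) : ℤ) < |(e:ℤ) - m|) :
    Summable (fun e : ℕ => if e ∈ E then V (lab e) ((e:ℤ) - m) else 0) := by
  rw [summable_iff_vanishing_norm]
  intro ε hε
  obtain ⟨K, hK⟩ := exists_pow_lt_of_lt_one (show 0 < ε/2 by positivity)
    (show (1/2:ℝ) < 1 by norm_num)
  refine ⟨Finset.range (m + N K + 1), fun t ht => ?_⟩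
  refine lt_of_le_of_lt (estimate V N hV E lab m K t ?_) (by linarith)
  intro e he hE
  have h1 : e ∉ Finset.range (m + N K + 1) := fun h => (Finset.disjoint_left.1 ht he) h
  rw [Finset.mem_range] at h1
  refine ⟨hm e hE (by omega), ?_⟩
  rw [lt_abs]; left; omega

/-- A dense sequence in `X₀` visiting every open set infinitely often. -/
lemma dense_seq {X : Type*} [NormedAddCommGroup X] [TopologicalSpace.SeparableSpace X]
    (X₀ : Set X) (hX₀ : Dense X₀) : ∃ y : ℕ → X, (∀ p, y p ∈ X₀) ∧
      ∀ U : Set X, IsOpen U → U.Nonempty → ∀ Q, ∃ q, Q ≤ q ∧ y q ∈ U := by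
  have hne : Nonempty X₀ := by
    obtain ⟨x, hx⟩ := hX₀.nonempty
    exact ⟨⟨x, hx⟩⟩
  have : SecondCountableTopology X := UniformSpace.secondCountable_of_separable X
  let d : ℕ → X₀ := TopologicalSpace.denseSeq X₀
  have hd : DenseRange d := TopologicalSpace.denseRange_denseSeq X₀
  refine ⟨fun p => d (Nat.unpair p).1, fun p => (d _).2, fun U hU hUne Q => ?_⟩
  obtain ⟨x, hxU, hx⟩ := hX₀.inter_open_nonempty U hU hUne
  obtain ⟨i, hi⟩ := hd.exists_mem_open (hU.preimage continuous_subtype_val) ⟨⟨x, hx⟩, hxU⟩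
  refine ⟨Nat.pair i Q, Nat.right_le_pair i Q, ?_⟩
  simpa using hi

lemma iter_sum {X : Type*} [AddCommGroup X] (D : Set X) (A : X → X)
    (hD0 : (0:X) ∈ D) (hDadd : ∀ x ∈ D, ∀ y ∈ D, x + y ∈ D) (hA0 : A 0 = 0)
    (hadd : ∀ x ∈ D, ∀ y ∈ D, A (x + y) = A x + A y)
    (w : ℕ → X) (hw : ∀ e i, A^[i] (w e) ∈ D) (F : Finset ℕ) (r : ℕ) :
    A^[r] (∑ e ∈ F, w e) = ∑ e ∈ F, A^[r] (w e) := by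
  have hmem : ∀ r, ∑ e ∈ F, A^[r] (w e) ∈ D := fun r =>
    Finset.sum_induction _ (· ∈ D) (fun a b ha hb => hDadd a ha b hb) hD0 (fun e _ => hw e r)
  have hs : ∀ r, ∀ G : Finset ℕ, A (∑ e ∈ G, A^[r] (w e)) = ∑ e ∈ G, A^[r+1] (w e) := by
    intro r G
    induction G using Finset.induction_on with
    | empty => simpa using hA0
    | insert a G ha ih =>
      rw [Finset.sum_insert ha, Finset.sum_insert ha, hadd _ (hw a r), ih,
        Function.iterate_succ_apply']
      exact Finset.sum_induction _ (· ∈ D) (fun a b ha hb => hDadd a ha b hb) hD0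
        (fun e _ => hw e r)
  induction r with
  | zero => rfl
  | succ r ih => rw [Function.iterate_succ_apply', ih, hs]

lemma iter_AB {X : Type*} (A B : X → X) (X₀ : Set X) (hB : ∀ x ∈ X₀, B x ∈ X₀)
    (h1 : ∀ x ∈ X₀, A (B x) = x) (x : X) (hx : x ∈ X₀) :
    (∀ k, B^[k] x ∈ X₀) ∧ (∀ r k, A^[r] (B^[r+k] x) = B^[k] x) ∧
    (∀ r k, A^[r+k] (B^[k] x) = A^[r] x) := by
  have hm : ∀ k, B^[k] x ∈ X₀ := by
    intro k
    induction k with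
    | zero => exact hx
    | succ k ih => rw [Function.iterate_succ_apply']; exact hB _ ih
  have h2 : ∀ r k, A^[r] (B^[r+k] x) = B^[k] x := by
    intro r
    induction r with
    | zero => intro k; simp
    | succ r ih =>
      intro k
      rw [Function.iterate_succ_apply, show r + 1 + k = (r + k) + 1 by ring,
        Function.iterate_succ_apply', h1 _ (hm _), ih]
  refine ⟨hm, h2, fun r k => ?_⟩
  have := h2 k 0
  rw [Function.iterate_add_apply]
  simp only [add_zero] at this
  rw [this]; rfl

lemma V_bound {X : Type*} [NormedAddCommGroup X] (A B : X → X) (n : ℕ) (hn : 1 ≤ n)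
    (y : ℕ → X) (h2 : ∀ p, UncondConv fun k => A^[k] (y p))
    (h3 : ∀ p, UncondConv fun k => B^[k] (y p)) :
    ∃ N : ℕ → ℕ, ∀ p K, ∀ F : Finset ℤ, (∀ i ∈ F, (N p : ℤ) < |i| ∧ (N K : ℤ) < |i|) →
      ‖∑ i ∈ F, (if 0 ≤ i then B^[n * i.toNat] (y p) else A^[n * (-i).toNat] (y p))‖
        ≤ (1/2:ℝ)^p * (1/2)^K := by
  have hN : ∀ L : ℕ, ∃ N : ℕ, ∀ j ≤ L, ∀ F : Finset ℕ, (∀ k ∈ F, N < k) →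
      ‖∑ k ∈ F, A^[k] (y j)‖ ≤ (1/4:ℝ)^L/2 ∧ ‖∑ k ∈ F, B^[k] (y j)‖ ≤ (1/4:ℝ)^L/2 := by
    intro L
    choose a _ ha using fun j => h2 j ((1/4:ℝ)^L/2) (by positivity)
    choose b _ hb using fun j => h3 j ((1/4:ℝ)^L/2) (by positivity)
    refine ⟨∑ j ∈ Finset.range (L+1), (a j + b j), fun j hj F hF => ?_⟩
    have : a j + b j ≤ ∑ j ∈ Finset.range (L+1), (a j + b j) :=
      Finset.single_le_sum (f := fun j => a j + b j) (fun _ _ => Nat.zero_le _)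
        (Finset.mem_range.2 (by omega))
    exact ⟨(ha j F fun k hk => by have := hF k hk; omega).le,
      (hb j F fun k hk => by have := hF k hk; omega).le⟩
  choose N hN using hN
  refine ⟨N, fun p K F hF => ?_⟩
  set L := max p K with hL
  have hFL : ∀ i ∈ F, (N L : ℤ) < |i| := by
    intro i hi
    rcases max_choice p K with h | h <;> rw [hL, h]
    exacts [(hF i hi).1, (hF i hi).2]
  have hle : (1/4:ℝ)^L ≤ (1/2)^p * (1/2)^K := by
    rw [show (1/4:ℝ) = (1/2)*(1/2) by norm_num, mul_pow]
    have e1 : (1/2:ℝ)^L ≤ (1/2)^p :=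
      pow_le_pow_of_le_one (by norm_num) (by norm_num) (le_max_left _ _)
    have e2 : (1/2:ℝ)^L ≤ (1/2)^K :=
      pow_le_pow_of_le_one (by norm_num) (by norm_num) (le_max_right _ _)
    gcongr
  rw [Finset.sum_ite]
  refine (norm_add_le _ _).trans ?_
  have hb : ‖∑ i ∈ F with 0 ≤ i, B^[n * i.toNat] (y p)‖ ≤ (1/4:ℝ)^L/2 := by
    have := (hN L p (le_max_left _ _)
      ((F.filter (fun i => 0 ≤ i)).image (fun i : ℤ => n * i.toNat)) ?_).2
    · rwa [Finset.sum_image] at this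
      intro i hi j hj h
      have hi := (Finset.mem_filter.1 hi).2
      have hj := (Finset.mem_filter.1 hj).2
      have := Nat.eq_of_mul_eq_mul_left (by omega) h
      omega
    · intro k hk
      obtain ⟨i, hi, rfl⟩ := Finset.mem_image.1 hk
      obtain ⟨hi, h0⟩ := Finset.mem_filter.1 hi
      have h := hFL i hi
      rw [abs_of_nonneg h0] at h
      have : N L < i.toNat := by omega
      nlinarith
  have ha : ‖∑ i ∈ F with ¬ 0 ≤ i, A^[n * (-i).toNat] (y p)‖ ≤ (1/4:ℝ)^L/2 := by
    have := (hN L p (le_max_left _ _)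
      ((F.filter (fun i => ¬ 0 ≤ i)).image (fun i : ℤ => n * (-i).toNat)) ?_).1
    · rwa [Finset.sum_image] at this
      intro i hi j hj h
      have hi := (Finset.mem_filter.1 hi).2
      have hj := (Finset.mem_filter.1 hj).2
      have := Nat.eq_of_mul_eq_mul_left (by omega) h
      omega
    · intro k hk
      obtain ⟨i, hi, rfl⟩ := Finset.mem_image.1 hk
      obtain ⟨hi, h0⟩ := Finset.mem_filter.1 hi
      have h := hFL i hi
      rw [abs_of_neg (by omega)] at h
      have : N L < (-i).toNat := by omega
      nlinarith
  linarith

/-- Let `X` be a real or complex infinite-dimensional separable Banach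
space and `A` a closed, densely defined linear operator on `X` with all powers `A^r`
closed, satisfying the Frequent Hypercyclicity Criterion with a dense subset
`X₀ ⊆ D^∞(A)` of the domain and a map `B : X₀ → X₀`.  Then every power `A^n` (`n ≥ 1`),
with its natural domain `D(A^n) = {x | A^i x ∈ D(A) for all i < n}`, is frequently
hypercyclic. -/
theorem stmt4 {𝕜 X : Type*} [RCLike 𝕜] [NormedAddCommGroup X] [NormedSpace 𝕜 X]
    [CompleteSpace X] [TopologicalSpace.SeparableSpace X]
    (hinfdim : ¬ FiniteDimensional 𝕜 X)
    (D : Submodule 𝕜 X) (A : X → X)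
    (hdense : Dense (D : Set X))
    (hadd : ∀ x ∈ D, ∀ y ∈ D, A (x + y) = A x + A y)
    (hsmul : ∀ c : 𝕜, ∀ x ∈ D, A (c • x) = c • A x)
    (hclosed : ∀ r : ℕ, 1 ≤ r → ∀ (u : ℕ → X) (a b : X),
      (∀ j, ∀ i < r, A^[i] (u j) ∈ D) →
      Tendsto u atTop (𝓝 a) → Tendsto (fun j => A^[r] (u j)) atTop (𝓝 b) →
      (∀ i < r, A^[i] a ∈ D) ∧ A^[r] a = b)
    (X₀ : Set X) (hX₀D : X₀ ⊆ D) (hX₀dense : Dense X₀)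
    (hX₀inf : ∀ x ∈ X₀, ∀ n : ℕ, A^[n] x ∈ D)
    (B : X → X) (hB : ∀ x ∈ X₀, B x ∈ X₀)
    (h1 : ∀ x ∈ X₀, A (B x) = x)
    (h2 : ∀ x ∈ X₀, UncondConv fun n => A^[n] x)
    (h3 : ∀ x ∈ X₀, UncondConv fun n => B^[n] x) :
    -- conclusion: every power `A^n`, `n ≥ 1`, is frequently hypercyclic
    ∀ n : ℕ, 1 ≤ n →
      FreqHypercyclic {x : X | ∀ i < n, A^[i] x ∈ D} (A^[n]) := by
  intro n hn
  obtain ⟨y, hy, hyd⟩ := dense_seq X₀ hX₀dense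
  obtain ⟨N, hV⟩ := V_bound A B n hn y (fun p => h2 _ (hy p)) (fun p => h3 _ (hy p))
  obtain ⟨E, lab, hE1, hE2, hE3, hE4⟩ := combin N
  set V : ℕ → ℤ → X := fun p i =>
    if 0 ≤ i then B^[n * i.toNat] (y p) else A^[n * (-i).toNat] (y p) with hVdef
  have hV' : ∀ p K, ∀ F : Finset ℤ, (∀ i ∈ F, (N p : ℤ) < |i| ∧ (N K : ℤ) < |i|) →
      ‖∑ i ∈ F, V p i‖ ≤ (1/2:ℝ)^p * (1/2)^K := hV
  let w : ℕ → ℕ → X := fun m e => if e ∈ E then V (lab e) ((e:ℤ) - m) else 0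
  have hA0 : A 0 = 0 := by simpa using hsmul 0 0 D.zero_mem
  have hA0i : ∀ r, A^[r] 0 = 0 := fun r => Function.iterate_fixed hA0 r
  have hw0 : ∀ e i, A^[i] (w 0 e) ∈ (D : Set X) := by
    intro e i
    by_cases he : e ∈ E
    · have : w 0 e = B^[n * e] (y (lab e)) := by simp [w, he, hVdef]
      rw [this]
      exact hX₀inf _ ((iter_AB A B X₀ hB h1 _ (hy _)).1 _) _
    · have : w 0 e = 0 := by simp [w, he]
      rw [this, hA0i]
      exact D.zero_mem
  have hwm : ∀ m e, A^[n * m] (w 0 e) = w m e := by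
    intro m e
    by_cases he : e ∈ E
    · have h0 : w 0 e = B^[n * e] (y (lab e)) := by simp [w, he, hVdef]
      obtain ⟨-, k1, k2⟩ := iter_AB A B X₀ hB h1 _ (hy (lab e))
      rw [h0]
      simp only [w, he, if_true, hVdef]
      split_ifs with h
      · have e1 : n * e = n * m + n * ((e:ℤ) - m).toNat := by
          rw [← mul_add]; congr 1; omega
        rw [e1, k1]
      · have e1 : n * m = n * (-((e:ℤ) - m)).toNat + n * e := by
          rw [← mul_add]; congr 1; omega
        rw [e1, k2]
    · simp [w, he, hA0i]
  have hsum0 : Summable (w 0) := summable_aux V N hV' E lab 0 fun e he _ => by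
    have := hE1 e he
    rw [lt_abs]; left; push_cast; omega
  have hsum : ∀ m ∈ E, Summable (w m) := fun m hm =>
    summable_aux V N hV' E lab m fun e he hne => hE2 e he m hm hne
  set f := ∑' e, w 0 e with hf
  have hmain : ∀ m ∈ E, (∀ i < n * m, A^[i] f ∈ D) ∧ A^[n * m] f = ∑' e, w m e := by
    intro m hm
    have hm1 : 1 ≤ m := by have := hE1 m hm; omega
    have hit := iter_sum (D : Set X) A D.zero_mem (fun x hx y hy => D.add_mem hx hy) hA0
      hadd (w 0) hw0
    refine hclosed (n * m) (Nat.mul_pos hn hm1) (fun j => ∑ e ∈ Finset.range j, w 0 e) f _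
      ?_ hsum0.hasSum.tendsto_sum_nat ?_
    · intro j i _
      rw [hit]
      exact D.sum_mem fun e _ => hw0 e i
    · simp only [hit, hwm]
      exact (hsum m hm).hasSum.tendsto_sum_nat
  have hfD : ∀ i, A^[i] f ∈ D := by
    intro i
    obtain ⟨m, hm, him⟩ := hE3 i
    exact (hmain m hm).1 i (by nlinarith)
  have hest : ∀ m ∈ E, ‖A^[n * m] f - y (lab m)‖ ≤ 2 * (1/2:ℝ)^(lab m) := by
    intro m hm
    rw [(hmain m hm).2]
    have ht : Tendsto (fun F : Finset ℕ => ‖∑ e ∈ F, w m e - y (lab m)‖) atTop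
        (𝓝 ‖∑' e, w m e - y (lab m)‖) := ((hsum m hm).hasSum.sub_const _).norm
    refine le_of_tendsto ht ?_
    filter_upwards [eventually_ge_atTop {m}] with F hF
    have hmF : m ∈ F := hF (Finset.mem_singleton_self m)
    have hwmm : w m m = y (lab m) := by simp [w, hm, hVdef]
    rw [← Finset.add_sum_erase F _ hmF, hwmm, add_sub_cancel_left]
    refine estimate V N hV' E lab m (lab m) _ fun e he heE => ?_
    have hne := Finset.ne_of_mem_erase he
    refine ⟨hE2 e heE m hm hne, ?_⟩
    rw [abs_sub_comm]
    exact hE2 m hm e heE hne.symm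
  refine ⟨f, fun i _ => hfD i, fun k _ i _ => ?_, fun U hU hUne => ?_⟩
  · rw [← Function.iterate_mul, ← Function.iterate_add_apply]
    exact hfD _
  · obtain ⟨x, hx⟩ := hUne
    obtain ⟨ε, hε, hball⟩ := Metric.isOpen_iff.1 hU x hx
    obtain ⟨K, hK⟩ := exists_pow_lt_of_lt_one (show 0 < ε/4 by positivity)
      (show (1/2:ℝ) < 1 by norm_num)
    obtain ⟨q, hq, hyq⟩ := hyd (Metric.ball x (ε/2)) Metric.isOpen_ball
      ⟨x, Metric.mem_ball_self (by positivity)⟩ K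
    refine hE4 q _ fun m hm hlab => ?_
    show (A^[n])^[m] f ∈ U
    rw [← Function.iterate_mul]
    apply hball
    have h := hest m hm
    rw [hlab] at h
    have hqK : (1/2:ℝ)^q ≤ (1/2)^K := pow_le_pow_of_le_one (by norm_num) (by norm_num) hq
    rw [Metric.mem_ball] at hyq ⊢
    have := dist_triangle (A^[n * m] f) (y q) x
    rw [dist_eq_norm (A^[n * m] f) (y q)] at this
    linarith
end

section
/- Let X be a real or complex infinite-dimensional separable Banach space and let A be a closed, densely defined linear operator on X with A^r closed for every positive integer r, admitting a dense subset X_0 of the domain of A with X_0 ⊆ D^∞(A) := ⋂_{n≥0} D(A^n) and a mapping B : X_0 → X_0 such that A B x = x, ∑_{n=1}^∞ A^n x converges unconditionally, and ∑_{n=1}^∞ B^n x converges unconditionally, for all x ∈ X_0. Then for every scalar λ with |λ| = 1, the operator λA is frequently hypercyclic. -/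
open Filter Topology
open scoped Classical

/-- Convexity lemma for multipliers in `[0,1]`. -/
lemma aux_convex {X : Type*} [NormedAddCommGroup X] [NormedSpace ℝ X] (x : ℕ → X) (a : ℕ → ℝ)
    (ha0 : ∀ n, 0 ≤ a n) (ha1 : ∀ n, a n ≤ 1) (C : ℝ) (F : Finset ℕ) :
    ∀ v : X, (∀ G ⊆ F, ‖v + ∑ k ∈ G, x k‖ ≤ C) → ‖v + ∑ k ∈ F, a k • x k‖ ≤ C := by
  induction F using Finset.induction_on with
  | empty => intro v h; simpa using h ∅ (by simp)
  | insert n F hn ih =>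
    intro v h
    have e1 : ‖v + ∑ k ∈ F, a k • x k‖ ≤ C :=
      ih v (fun G hG => h G (hG.trans (Finset.subset_insert _ _)))
    have e2 : ‖(v + x n) + ∑ k ∈ F, a k • x k‖ ≤ C := by
      refine ih _ (fun G hG => ?_)
      have := h (insert n G) (Finset.insert_subset_insert _ hG)
      rwa [Finset.sum_insert (fun hh => hn (hG hh)), ← add_assoc] at this
    rw [Finset.sum_insert hn]
    have : v + (a n • x n + ∑ k ∈ F, a k • x k) =
        (1 - a n) • (v + ∑ k ∈ F, a k • x k) + a n • ((v + x n) + ∑ k ∈ F, a k • x k) := by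
      module
    rw [this]
    refine (norm_add_le _ _).trans ?_
    rw [norm_smul, norm_smul, Real.norm_of_nonneg (ha0 n),
      Real.norm_of_nonneg (sub_nonneg.2 (ha1 n))]
    nlinarith [ha0 n, ha1 n]

lemma aux_summable {X : Type*} [NormedAddCommGroup X] [CompleteSpace X] (x : ℕ → X)
    (h : UncondConv x) : Summable x := by
  rw [summable_iff_vanishing_norm]
  intro ε hε
  obtain ⟨N, -, hN⟩ := h ε hε
  refine ⟨Finset.range (N + 1), fun t ht => hN t fun k hk => ?_⟩
  have := Finset.disjoint_left.1 ht hk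
  simp at this; omega

lemma aux_smul01 {X : Type*} [NormedAddCommGroup X] [NormedSpace ℝ X] [CompleteSpace X]
    (x : ℕ → X) (h : UncondConv x) (a : ℕ → ℝ)
    (ha0 : ∀ n, 0 ≤ a n) (ha1 : ∀ n, a n ≤ 1) : Summable (fun n => a n • x n) := by
  apply aux_summable
  intro ε hε
  obtain ⟨N, h1, hN⟩ := h (ε / 2) (by positivity)
  refine ⟨N, h1, fun F hF => ?_⟩
  have := aux_convex x a ha0 ha1 (ε / 2) F 0
    (fun G hG => by simpa using (hN G (fun k hk => hF k (hG hk))).le)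
  rw [zero_add] at this
  linarith

lemma aux_smul {𝕜 X : Type*} [RCLike 𝕜] [NormedAddCommGroup X] [NormedSpace 𝕜 X]
    [CompleteSpace X] (x : ℕ → X) (h : UncondConv x) (a : ℕ → 𝕜)
    (ha : ∀ n, ‖a n‖ ≤ 1) : Summable (fun n => a n • x n) := by
  let _ : NormedSpace ℝ X := NormedSpace.restrictScalars ℝ 𝕜 X
  have key : ∀ b : ℕ → ℝ, (∀ n, |b n| ≤ 1) → Summable (fun n => ((b n : ℝ) : 𝕜) • x n) := by
    intro b hb
    have h1 := aux_smul01 x h (fun n => max (b n) 0) (fun n => le_max_right _ _)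
      (fun n => max_le (abs_le.1 (hb n)).2 zero_le_one)
    have h2 := aux_smul01 x h (fun n => max (-b n) 0) (fun n => le_max_right _ _)
      (fun n => max_le (by linarith [(abs_le.1 (hb n)).1]) zero_le_one)
    refine (h1.sub h2).congr fun n => ?_
    rw [← sub_smul]
    have : max (b n) 0 - max (-b n) 0 = b n := by
      rcases le_total (b n) 0 with h | h
      · rw [max_eq_right h, max_eq_left (by linarith)]; ring
      · rw [max_eq_left h, max_eq_right (by linarith)]; ring
    rw [this]
    rfl
  have hre := key (fun n => RCLike.re (a n)) (fun n => (RCLike.abs_re_le_norm _).trans (ha n))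
  have him := key (fun n => RCLike.im (a n)) (fun n => (RCLike.abs_im_le_norm _).trans (ha n))
  refine (hre.add (him.const_smul (RCLike.I : 𝕜))).congr fun n => ?_
  rw [smul_smul, ← add_smul]
  congr 1
  conv_lhs => rw [mul_comm]
  exact RCLike.re_add_im (a n)

/-- Counting lemma: well separated colour classes of positive lower density. -/
lemma aux_color (ν : ℕ → ℕ) : ∃ c : ℕ → Option ℕ,
    (∀ n m j l, c n = some j → c m = some l → n ≠ m → (ν j : ℤ) < |(n : ℤ) - m|) ∧
    (∀ n j, c n = some j → ν j < n) ∧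
    (∀ j, ∃ M : ℕ, 0 < M ∧ ∀ N, N / M ≤ ((Finset.Icc 1 N).filter (fun n => c n = some j)).card) := by
  obtain ⟨p, hpm, hp⟩ : ∃ p : ℕ → ℕ, StrictMono p ∧ ∀ l, 2 ^ l * ν l ≤ 2 ^ p l := by
    refine ⟨fun l => ∑ i ∈ Finset.range (l + 1), (i + ν i + 1), ?_, ?_⟩
    · refine strictMono_nat_of_lt_succ fun l => ?_
      rw [Finset.sum_range_succ _ (l + 1)]; omega
    · intro l
      have h1 : ν l ≤ 2 ^ ν l := Nat.lt_two_pow_self.le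
      calc 2 ^ l * ν l ≤ 2 ^ l * 2 ^ ν l := Nat.mul_le_mul_left _ h1
        _ = 2 ^ (l + ν l) := (pow_add _ _ _).symm
        _ ≤ _ := by
          apply Nat.pow_le_pow_right (by norm_num)
          change _ ≤ ∑ i ∈ Finset.range (l + 1), (i + ν i + 1)
          rw [Finset.sum_range_succ]; omega
  set w : ℕ → ℕ := fun k =>
    1 + ∑ l ∈ Finset.range (k + 1), if 2 ^ p l ∣ k + 1 then ν l else 0 with hw
  set s : ℕ → ℕ := fun k => ∑ i ∈ Finset.range k, w i with hs
  have hs1 : ∀ k, s (k + 1) = s k + w k := fun k => Finset.sum_range_succ _ _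
  have hsm : Monotone s := monotone_nat_of_le_succ fun k => by rw [hs1]; omega
  set q : ℕ → ℕ := fun k => s k + s (k + 1) with hq
  have hsep : ∀ k k', k < k' → q k + w k + w k' ≤ q k' := by
    intro k k' h
    have a1 := hsm (Nat.succ_le_of_lt h)
    simp only [Nat.succ_eq_add_one] at a1
    simp only [hq, hs1] at *
    omega
  have hqm : StrictMono q := by
    intro k k' h
    have := hsep k k' h
    have : 1 ≤ w k := by simp [hw]
    omega
  have hwb : ∀ k l, (k + 1) % 2 ^ (p l + 1) = 2 ^ p l → ν l < w k := by
    intro k l h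
    have hd : 2 ^ p l ∣ k + 1 := by
      have := Nat.div_add_mod (k + 1) (2 ^ (p l + 1))
      rw [h, pow_succ] at this
      rw [← this, mul_assoc]
      exact Dvd.intro _ (by ring : 2 ^ p l * (2 * ((k + 1) / (2 ^ p l * 2)) + 1) = _)
    have hl : l ∈ Finset.range (k + 1) := by
      have h1 := Nat.le_of_dvd (Nat.succ_pos k) hd
      have h2 : p l < 2 ^ p l := Nat.lt_two_pow_self
      have h3 := hpm.id_le l
      simp only [id] at h3
      simp; omega
    have := Finset.single_le_sum (f := fun l => if 2 ^ p l ∣ k + 1 then ν l else 0)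
      (fun _ _ => Nat.zero_le _) hl
    simp only [hd, if_true] at this
    simp only [hw]; omega
  have hsK : ∀ K, s K ≤ 3 * K := by
    intro K
    have e1 : s K ≤ K + ∑ l ∈ Finset.range K, ν l * (K / 2 ^ p l) := by
      simp only [hs, hw, Finset.sum_add_distrib]
      simp only [Finset.sum_const, Finset.card_range, smul_eq_mul, mul_one]
      apply Nat.add_le_add_left
      calc _ ≤ ∑ k ∈ Finset.range K, ∑ l ∈ Finset.range K, (if 2 ^ p l ∣ k + 1 then ν l else 0) := by
            apply Finset.sum_le_sum
            intro k hk
            apply Finset.sum_le_sum_of_subset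
            intro l hl
            simp at *; omega
        _ = _ := by
            rw [Finset.sum_comm]
            refine Finset.sum_congr rfl fun l _ => ?_
            rw [← Finset.sum_filter, Finset.sum_const, Nat.card_multiples, smul_eq_mul, mul_comm]
    have e2 : ((∑ l ∈ Finset.range K, ν l * (K / 2 ^ p l) : ℕ) : ℝ) ≤ 2 * K := by
      push_cast
      calc _ ≤ ∑ l ∈ Finset.range K, (1 / 2 : ℝ) ^ l * K := by
            apply Finset.sum_le_sum
            intro l _
            have a1 : ((K / 2 ^ p l : ℕ) : ℝ) ≤ (K : ℝ) / 2 ^ p l := by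
              have := @Nat.cast_div_le ℝ _ _ _ K (2 ^ p l)
              simpa using this
            have a2 : ((2 : ℝ) ^ l * ν l) ≤ 2 ^ p l := by exact_mod_cast hp l
            calc (ν l : ℝ) * ((K / 2 ^ p l : ℕ) : ℝ) ≤ ν l * ((K : ℝ) / 2 ^ p l) := by gcongr
              _ = (ν l / 2 ^ p l) * K := by ring
              _ ≤ (1 / 2 : ℝ) ^ l * K := by
                gcongr
                rw [div_pow, one_pow, div_le_div_iff₀ (by positivity) (by positivity)]
                linarith
        _ = (∑ l ∈ Finset.range K, (1 / 2 : ℝ) ^ l) * K := by rw [Finset.sum_mul]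
        _ ≤ 2 * K := by
            gcongr
            exact sum_geometric_two_le K
    have e3 : (∑ l ∈ Finset.range K, ν l * (K / 2 ^ p l)) ≤ 2 * K := by exact_mod_cast e2
    omega
  set P : ℕ → ℕ → Prop := fun n l => ∃ k, q k = n ∧ (k + 1) % 2 ^ (p l + 1) = 2 ^ p l with hP
  have hmod : ∀ a l l', l < l' → a % 2 ^ (p l + 1) = 2 ^ p l → a % 2 ^ (p l' + 1) = 2 ^ p l' → False := by
    intro a l l' hl h h'
    have hlt : p l + 1 ≤ p l' := hpm hl
    have h1 : a % 2 ^ (p l + 1) = (a % 2 ^ (p l' + 1)) % 2 ^ (p l + 1) :=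
      (Nat.mod_mod_of_dvd _ (pow_dvd_pow _ (by omega))).symm
    rw [h', h, Nat.mod_eq_zero_of_dvd (pow_dvd_pow _ hlt)] at h1
    have : 0 < 2 ^ p l := by positivity
    omega
  have huniq : ∀ n l l', P n l → P n l' → l = l' := by
    rintro n l l' ⟨k, rfl, hk⟩ ⟨k', he, hk'⟩
    have := hqm.injective he
    subst this
    rcases lt_trichotomy l l' with h | h | h
    · exact (hmod _ _ _ h hk hk').elim
    · exact h
    · exact (hmod _ _ _ h hk' hk).elim
  set c : ℕ → Option ℕ := fun n => if h : ∃ l, P n l then some h.choose else none with hc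
  have hcP : ∀ n l, c n = some l ↔ P n l := by
    intro n l
    simp only [hc]
    constructor
    · intro h
      split_ifs at h with hh
      · have := hh.choose_spec
        rwa [Option.some.inj h] at this
    · intro h
      have hh : ∃ l, P n l := ⟨l, h⟩
      rw [dif_pos hh, huniq n _ _ hh.choose_spec h]
  refine ⟨c, ?_, ?_, ?_⟩
  · intro n m j l h h' hne
    rw [hcP] at h h'
    obtain ⟨k, rfl, hk⟩ := h
    obtain ⟨k', rfl, hk'⟩ := h'
    have h1 := hwb _ _ hk
    rw [lt_abs]
    rcases lt_trichotomy k k' with h | h | h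
    · have := hsep _ _ h; right; omega
    · subst h; exact (hne rfl).elim
    · have := hsep _ _ h; left; omega
  · intro n j h
    rw [hcP] at h
    obtain ⟨k, rfl, hk⟩ := h
    have h1 := hwb _ _ hk
    simp only [hq, hs1]; omega
  · intro j
    refine ⟨12 * 2 ^ p j, by positivity, fun N => ?_⟩
    have hinj : Function.Injective (fun t => q (2 ^ p j * (2 * t + 1) - 1)) := by
      intro t t' h
      have h := hqm.injective h
      have b : 0 < 2 ^ p j := by positivity
      have b1 : 0 < 2 ^ p j * (2 * t + 1) := by positivity
      have b2 : 0 < 2 ^ p j * (2 * t' + 1) := by positivity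
      have h2 : 2 ^ p j * (2 * t + 1) = 2 ^ p j * (2 * t' + 1) := by omega
      have := Nat.eq_of_mul_eq_mul_left b h2
      omega
    rw [← Finset.card_range (N / (12 * 2 ^ p j)), ← Finset.card_image_of_injective _ hinj]
    apply Finset.card_le_card
    intro n hn
    rw [Finset.mem_image] at hn
    obtain ⟨t, ht, rfl⟩ := hn
    have b1 : 0 < 2 ^ p j * (2 * t + 1) := by positivity
    rw [Finset.mem_filter, Finset.mem_Icc, hcP]
    have hcol : (2 ^ p j * (2 * t + 1) - 1 + 1) % 2 ^ (p j + 1) = 2 ^ p j := by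
      rw [Nat.sub_add_cancel b1]
      have : 2 ^ p j * (2 * t + 1) = 2 ^ p j + 2 ^ (p j + 1) * t := by ring
      rw [this, Nat.add_mul_mod_self_left]
      exact Nat.mod_eq_of_lt (Nat.pow_lt_pow_right (by norm_num) (by omega))
    refine ⟨⟨?_, ?_⟩, ⟨_, rfl, hcol⟩⟩
    · have := hwb _ _ hcol
      simp only [hq, hs1]; omega
    · rw [Finset.mem_range, Nat.lt_iff_add_one_le, Nat.le_div_iff_mul_le (by positivity)] at ht
      have a1 := hsK (2 ^ p j * (2 * t + 1) - 1)
      have a2 := hsK (2 ^ p j * (2 * t + 1) - 1 + 1)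
      have a3 : 6 * (2 ^ p j * (2 * t + 1)) ≤ (t + 1) * (12 * 2 ^ p j) := by nlinarith
      simp only [hq]
      omega

/-- The vanishing condition for series over `ℤ`. -/
lemma aux_vanish {X : Type*} [NormedAddCommGroup X] (W : ℤ → X) (h : Summable W)
    (ε : ℝ) (hε : 0 < ε) :
    ∃ N : ℕ, ∀ F : Finset ℤ, (∀ k ∈ F, (N : ℤ) < |k|) → ‖∑ k ∈ F, W k‖ < ε := by
  have h' : CauchySeq fun s : Finset ℤ => ∑ k ∈ s, W k := h.hasSum.cauchySeq
  rw [cauchySeq_finset_iff_vanishing_norm] at h'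
  obtain ⟨s, hs⟩ := h' ε hε
  refine ⟨∑ k ∈ s, k.natAbs, fun F hF => hs F ?_⟩
  rw [Finset.disjoint_left]
  intro k hk hks
  have h1 := hF k hk
  have h2 := Finset.single_le_sum (f := fun k : ℤ => k.natAbs) (fun _ _ => Nat.zero_le _) hks
  rw [Int.abs_eq_natAbs] at h1
  omega

/-- The shifted coloured series. -/
noncomputable def hser {X : Type*} [Zero X] (W : ℕ → ℤ → X) (c : ℕ → Option ℕ) (m n : ℕ) : X :=
  match c n with
  | none => 0
  | some j => W j ((n : ℤ) - m)

lemma hser_fiber {X : Type*} [NormedAddCommGroup X] (W : ℕ → ℤ → X) (c : ℕ → Option ℕ)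
    (m : ℕ) (F : Finset ℕ) : ∃ R : ℕ, ∑ n ∈ F, hser W c m n =
      ∑ j ∈ Finset.range R, ∑ k ∈ (F.filter (fun n => c n = some j)).image
        (fun n : ℕ => (n : ℤ) - m), W j k := by
  refine ⟨∑ n ∈ F, ((c n).getD 0 + 1), ?_⟩
  have e : ∀ j, ∑ k ∈ (F.filter (fun n => c n = some j)).image
        (fun n : ℕ => (n : ℤ) - m), W j k = ∑ n ∈ F, if c n = some j then hser W c m n else 0 := by
    intro j
    rw [Finset.sum_image (fun a _ b _ h => by simpa using h), Finset.sum_filter]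
    refine Finset.sum_congr rfl fun n _ => ?_
    split_ifs with h
    · simp [hser, h]
    · rfl
  simp only [e]
  rw [Finset.sum_comm]
  refine Finset.sum_congr rfl fun n hn => ?_
  have hle := Finset.single_le_sum (f := fun n => (c n).getD 0 + 1) (fun _ _ => Nat.zero_le _) hn
  cases hcn : c n with
  | none => simp [hser, hcn]
  | some j =>
    rw [hcn] at hle
    simp only [Option.getD_some] at hle
    rw [Finset.sum_eq_single j]
    · simp
    · intro b _ hb
      rw [if_neg]
      intro h
      exact hb (Option.some.inj h).symm
    · intro h
      simp at h; omega

lemma hser_summable {X : Type*} [NormedAddCommGroup X] [CompleteSpace X] (W : ℕ → ℤ → X)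
    (hW : ∀ j, Summable (W j)) (c : ℕ → Option ℕ) (ν : ℕ → ℕ)
    (hν : ∀ j, ∀ F : Finset ℤ, (∀ k ∈ F, (ν j : ℤ) < |k|) → ‖∑ k ∈ F, W j k‖ ≤ (1 / 2) ^ j * (1 / 2) ^ j)
    (m : ℕ) (hm : ∀ n j, c n = some j → n ≠ m → (ν j : ℤ) < |(n : ℤ) - m|) :
    Summable (hser W c m) := by
  rw [summable_iff_vanishing_norm]
  intro ε hε
  obtain ⟨J, hJ⟩ := exists_pow_lt_of_lt_one (show 0 < ε / 4 by positivity)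
    (show (1 / 2 : ℝ) < 1 by norm_num)
  choose K hK using fun j => aux_vanish (W j) (hW j) (ε / 4 * (1 / 2) ^ j) (by positivity)
  refine ⟨Finset.range (m + 1 + ∑ j ∈ Finset.range J, (K j + 1)), fun F hF => ?_⟩
  have hF' : ∀ n ∈ F, m + 1 + ∑ j ∈ Finset.range J, (K j + 1) ≤ n := fun n hn => by
    simpa using Finset.disjoint_left.1 hF hn
  obtain ⟨R, hR⟩ := hser_fiber W c m F
  rw [hR]
  set a : ℕ → ℝ := fun j => ‖∑ k ∈ (F.filter (fun n => c n = some j)).image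
        (fun n : ℕ => (n : ℤ) - m), W j k‖ with ha
  have ha1 : ∀ j, a j ≤ (1 / 2) ^ j * (1 / 2) ^ j := by
    intro j
    apply hν
    intro k hk
    simp only [Finset.mem_image, Finset.mem_filter] at hk
    obtain ⟨n, ⟨hn, hc⟩, rfl⟩ := hk
    exact hm n j hc (by have := hF' n hn; omega)
  have ha2 : ∀ j < J, a j ≤ ε / 4 * (1 / 2) ^ j := by
    intro j hj
    apply (hK j _ _).le
    intro k hk
    simp only [Finset.mem_image, Finset.mem_filter] at hk
    obtain ⟨n, ⟨hn, hc⟩, rfl⟩ := hk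
    have h1 := hF' n hn
    have h2 := Finset.single_le_sum (f := fun j => K j + 1) (fun _ _ => Nat.zero_le _)
      (Finset.mem_range.2 hj)
    rw [lt_abs]; left; omega
  have ha3 : ∀ j, a j ≤ ε / 4 * (1 / 2) ^ j := by
    intro j
    rcases lt_or_ge j J with hj | hj
    · exact ha2 j hj
    · refine (ha1 j).trans ?_
      have : (1 / 2 : ℝ) ^ j ≤ (1 / 2) ^ J := pow_le_pow_of_le_one (by norm_num) (by norm_num) hj
      gcongr
      linarith
  calc _ ≤ ∑ j ∈ Finset.range R, a j := norm_sum_le _ _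
    _ ≤ ∑ j ∈ Finset.range R, ε / 4 * (1 / 2) ^ j := Finset.sum_le_sum fun j _ => ha3 j
    _ = ε / 4 * ∑ j ∈ Finset.range R, (1 / 2 : ℝ) ^ j := by rw [Finset.mul_sum]
    _ ≤ ε / 4 * 2 := by gcongr; exact sum_geometric_two_le R
    _ < ε := by linarith

lemma hser_bound {X : Type*} [NormedAddCommGroup X] [CompleteSpace X] (W : ℕ → ℤ → X)
    (c : ℕ → Option ℕ) (m l : ℕ) (hml : c m = some l) (hs : Summable (hser W c m))
    (hb : ∀ j, ∀ F : Finset ℕ, m ∉ F →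
      ‖∑ k ∈ (F.filter (fun n => c n = some j)).image
        (fun n : ℕ => (n : ℤ) - m), W j k‖ ≤ (1 / 2) ^ l * (1 / 2) ^ j) :
    ‖(∑' n, hser W c m n) - W l 0‖ ≤ 2 * (1 / 2) ^ l := by
  have h0 : hser W c m m = W l 0 := by simp [hser, hml]
  have ht : Tendsto (fun F : Finset ℕ => ‖(∑ n ∈ F, hser W c m n) - W l 0‖) atTop
      (𝓝 ‖(∑' n, hser W c m n) - W l 0‖) :=
    ((hs.hasSum : Tendsto _ _ _).sub_const _).norm
  refine le_of_tendsto ht ?_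
  filter_upwards [eventually_ge_atTop {m}] with F hF
  have hmF : m ∈ F := hF (Finset.mem_singleton_self m)
  rw [← Finset.sum_erase_add F _ hmF, h0, add_sub_cancel_right]
  obtain ⟨R, hR⟩ := hser_fiber W c m (F.erase m)
  rw [hR]
  refine (norm_sum_le _ _).trans ?_
  refine (Finset.sum_le_sum fun j _ => hb j _ (by simp)).trans ?_
  rw [← Finset.mul_sum, mul_comm]
  gcongr
  exact sum_geometric_two_le R

lemma aux_density (S T : Set ℕ) (hST : T ⊆ S) (M : ℕ) (hM : 0 < M)
    (h : ∀ N, N / M ≤ ((Finset.Icc 1 N).filter (fun n => n ∈ T)).card) : 0 < lowerDensity S := by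
  have hb : (1 / (2 * M) : ℝ) ≤ lowerDensity S := by
    unfold lowerDensity
    refine le_liminf_of_le ?_ ?_
    · refine IsBoundedUnder.isCoboundedUnder_ge ⟨1, ?_⟩
      rw [eventually_map]
      refine Eventually.of_forall fun N => ?_
      refine div_le_one_of_le₀ ?_ (Nat.cast_nonneg _)
      have := Finset.card_filter_le (Finset.Icc 1 N) (fun n => n ∈ S)
      simp only [Nat.card_Icc, Nat.add_sub_cancel] at this
      exact_mod_cast this
    · filter_upwards [eventually_ge_atTop M] with N hN
      have h1 := (h N).trans (Finset.card_le_card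
        (Finset.monotone_filter_right (Finset.Icc 1 N) (fun n _ hn => hST hn)))
      have h2 : N ≤ 2 * M * (N / M) := by
        have a := Nat.div_add_mod N M
        have b := Nat.mod_lt N hM
        have c : 1 ≤ N / M := (Nat.one_le_div_iff hM).2 hN
        nlinarith
      have h3 := h2.trans (Nat.mul_le_mul_left (2 * M) h1)
      have hN0 : (0 : ℝ) < N := by exact_mod_cast hM.trans_le hN
      have hM0 : (0 : ℝ) < M := by exact_mod_cast hM
      rw [div_le_div_iff₀ (by positivity) hN0]
      have h4 : (N : ℝ) ≤ 2 * M * (((Finset.Icc 1 N).filter (fun n => n ∈ S)).card : ℝ) := by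
        exact_mod_cast h3
      linarith
  have : (0 : ℝ) < 1 / (2 * M) := by
    have hM0 : (0 : ℝ) < M := by exact_mod_cast hM
    positivity
  linarith

/-- Let `X` be a real or complex infinite-dimensional separable Banach
space and `A` a closed, densely defined linear operator on `X` with all powers `A^r`
closed, satisfying the Frequent Hypercyclicity Criterion with a dense subset
`X₀ ⊆ D^∞(A)` of the domain and a map `B : X₀ → X₀`.  Then for every scalar `λ` with
`|λ| = 1`, the operator `λ A` (with the same domain `D(A)`) is frequently hypercyclic. -/
theorem stmt5 {𝕜 X : Type*} [RCLike 𝕜] [NormedAddCommGroup X] [NormedSpace 𝕜 X]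
    [CompleteSpace X] [TopologicalSpace.SeparableSpace X]
    (hinfdim : ¬ FiniteDimensional 𝕜 X)
    (D : Submodule 𝕜 X) (A : X → X)
    (hdense : Dense (D : Set X))
    (hadd : ∀ x ∈ D, ∀ y ∈ D, A (x + y) = A x + A y)
    (hsmul : ∀ c : 𝕜, ∀ x ∈ D, A (c • x) = c • A x)
    (hclosed : ∀ r : ℕ, 1 ≤ r → ∀ (u : ℕ → X) (a b : X),
      (∀ j, ∀ i < r, A^[i] (u j) ∈ D) →
      Tendsto u atTop (𝓝 a) → Tendsto (fun j => A^[r] (u j)) atTop (𝓝 b) →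
      (∀ i < r, A^[i] a ∈ D) ∧ A^[r] a = b)
    (X₀ : Set X) (hX₀D : X₀ ⊆ D) (hX₀dense : Dense X₀)
    (hX₀inf : ∀ x ∈ X₀, ∀ n : ℕ, A^[n] x ∈ D)
    (B : X → X) (hB : ∀ x ∈ X₀, B x ∈ X₀)
    (h1 : ∀ x ∈ X₀, A (B x) = x)
    (h2 : ∀ x ∈ X₀, UncondConv fun n => A^[n] x)
    (h3 : ∀ x ∈ X₀, UncondConv fun n => B^[n] x) :
    -- conclusion: `λ A` is frequently hypercyclic for every scalar `λ` with `|λ| = 1`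
    ∀ lam : 𝕜, ‖lam‖ = 1 →
      FreqHypercyclic (D : Set X) (fun x => lam • A x) := by
  intro lam hlam
  have hlam0 : lam ≠ 0 := by
    intro h; rw [h, norm_zero] at hlam; exact zero_ne_one hlam
  -- a dense sequence in `X₀` with infinite repetitions
  obtain ⟨d, hdX, hdd⟩ : ∃ d : ℕ → X, (∀ i, d i ∈ X₀) ∧
      ∀ U : Set X, IsOpen U → U.Nonempty → ∃ i, d i ∈ U := by
    have hne : Nonempty X₀ := hX₀dense.nonempty.to_subtype
    have : TopologicalSpace.SeparableSpace X₀ := inferInstance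
    refine ⟨fun i => (TopologicalSpace.denseSeq X₀ i : X), fun i => Subtype.coe_prop _, ?_⟩
    intro U hU hUne
    obtain ⟨y, hyU, hy⟩ := hX₀dense.inter_open_nonempty U hU hUne
    obtain ⟨z, hz, i, rfl⟩ := (TopologicalSpace.denseRange_denseSeq X₀).inter_open_nonempty
      ((fun z : X₀ => (z : X)) ⁻¹' U) (hU.preimage continuous_subtype_val) ⟨⟨y, hy⟩, hyU⟩
    exact ⟨i, hz⟩
  set x : ℕ → X := fun l => d (Nat.unpair l).1 with hx
  have hxX : ∀ l, x l ∈ X₀ := fun l => hdX _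
  have hBX : ∀ y ∈ X₀, ∀ n, B^[n] y ∈ X₀ := by
    intro y hy n
    induction n with
    | zero => exact hy
    | succ n ih => rw [Function.iterate_succ_apply']; exact hB _ ih
  -- two-sided orbits
  set V : ℕ → ℤ → X := fun j k => if 0 ≤ k then B^[k.natAbs] (x j) else A^[k.natAbs] (x j) with hV
  have hVD : ∀ j k, V j k ∈ D := by
    intro j k
    simp only [hV]
    split_ifs
    · exact hX₀D (hBX _ (hxX j) _)
    · exact hX₀inf _ (hxX j) _
  have hAV : ∀ j k, A (V j k) = V j (k - 1) := by
    intro j k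
    simp only [hV]
    rcases lt_trichotomy k 0 with h | h | h
    · rw [if_neg (by omega), if_neg (by omega), ← Function.iterate_succ_apply' A]
      congr 1
      have : (k - 1).natAbs = k.natAbs + 1 := by omega
      rw [this]
    · subst h; simp
    · rw [if_pos (by omega), if_pos (by omega)]
      have : k.natAbs = (k - 1).natAbs + 1 := by omega
      rw [this, Function.iterate_succ_apply', h1 _ (hBX _ (hxX j) _)]
  have hAmV : ∀ m j k, A^[m] (V j k) = V j (k - m) := by
    intro m
    induction m with
    | zero => intro j k; simp
    | succ m ih =>
      intro j k
      rw [Function.iterate_succ_apply', ih, hAV]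
      congr 1; push_cast; ring
  set W : ℕ → ℤ → X := fun j k => (lam ^ (-k)) • V j k with hW
  have hWs : ∀ j, Summable (W j) := by
    intro j
    apply Summable.of_nat_of_neg
    · refine (aux_smul _ (h3 _ (hxX j)) (fun n : ℕ => lam ^ (-(n : ℤ))) ?_).congr ?_
      · intro n; rw [norm_zpow, hlam, one_zpow]
      · intro n; simp [hW, hV]
    · refine (aux_smul _ (h2 _ (hxX j)) (fun n : ℕ => lam ^ ((n : ℤ))) ?_).congr ?_
      · intro n; rw [norm_zpow, hlam, one_zpow]
      · intro n
        rcases Nat.eq_zero_or_pos n with h | h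
        · subst h; simp [hW, hV]
        · simp only [hW, hV]
          rw [if_neg (by omega), neg_neg, Int.natAbs_neg, Int.natAbs_natCast]
  obtain ⟨ν, hν⟩ : ∃ ν : ℕ → ℕ, ∀ l, ∀ j ≤ l, ∀ F : Finset ℤ, (∀ k ∈ F, (ν l : ℤ) < |k|) →
      ‖∑ k ∈ F, W j k‖ ≤ (1 / 2) ^ l * (1 / 2) ^ l := by
    choose K hK using fun l j =>
      aux_vanish (W j) (hWs j) ((1 / 2) ^ l * (1 / 2) ^ l) (by positivity)
    refine ⟨fun l => ∑ j ∈ Finset.range (l + 1), K l j, fun l j hj F hF => (hK l j F ?_).le⟩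
    intro k hk
    have a1 := hF k hk
    have a2 := Finset.single_le_sum (f := fun j => K l j) (fun _ _ => Nat.zero_le _)
      (Finset.mem_range.2 (Nat.lt_succ_of_le hj))
    have a3 : (K l j : ℤ) ≤ ((∑ j ∈ Finset.range (l + 1), K l j : ℕ) : ℤ) := by exact_mod_cast a2
    exact a3.trans_lt a1
  obtain ⟨c, hc1, hc2, hc3⟩ := aux_color ν
  have hS0 : Summable (hser W c 0) := by
    refine hser_summable W hWs c ν (fun j => hν j j le_rfl) 0 ?_
    intro n j hn _
    have := hc2 n j hn
    rw [lt_abs]; left; push_cast; omega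
  have hSm : ∀ m l, c m = some l → Summable (hser W c m) := by
    intro m l hm
    refine hser_summable W hWs c ν (fun j => hν j j le_rfl) m ?_
    intro n j hn hne
    exact hc1 n m j l hn hm hne
  have hbd : ∀ m l, c m = some l → ‖(∑' n, hser W c m n) - x l‖ ≤ 2 * (1 / 2) ^ l := by
    intro m l hm
    have hx0 : W l 0 = x l := by simp [hW, hV]
    rw [← hx0]
    refine hser_bound W c m l hm (hSm m l hm) ?_
    intro j F hmF
    have hle : ∀ a b : ℕ, a ≤ b → (1 / 2 : ℝ) ^ b ≤ (1 / 2) ^ a := fun a b h =>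
      pow_le_pow_of_le_one (by norm_num) (by norm_num) h
    rcases le_total j l with h | h
    · refine (hν l j h _ ?_).trans ?_
      · intro k hk
        simp only [Finset.mem_image, Finset.mem_filter] at hk
        obtain ⟨n, ⟨hn, hcn⟩, rfl⟩ := hk
        rw [abs_sub_comm]
        exact hc1 m n l j hm hcn (by rintro rfl; exact hmF hn)
      · gcongr _ * ?_
        exact hle _ _ h
    · refine (hν j j le_rfl _ ?_).trans ?_
      · intro k hk
        simp only [Finset.mem_image, Finset.mem_filter] at hk
        obtain ⟨n, ⟨hn, hcn⟩, rfl⟩ := hk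
        exact hc1 n m j l hcn hm (by rintro rfl; exact hmF hn)
      · gcongr ?_ * _
        exact hle _ _ h
  -- linearity of the operator
  have hA0 : A 0 = 0 := by simpa using hsmul 0 0 D.zero_mem
  have hA0' : ∀ i, A^[i] 0 = 0 := fun i => Function.iterate_fixed hA0 i
  have hsm : ∀ (a : 𝕜) (y : X), (∀ i, A^[i] y ∈ D) → ∀ i, A^[i] (a • y) = a • A^[i] y := by
    intro a y hy i
    induction i with
    | zero => rfl
    | succ i ih =>
      rw [Function.iterate_succ_apply', ih, hsmul _ _ (hy i), Function.iterate_succ_apply']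
  have had : ∀ y z : X, (∀ i, A^[i] y ∈ D) → (∀ i, A^[i] z ∈ D) →
      ∀ i, A^[i] (y + z) = A^[i] y + A^[i] z := by
    intro y z hy hz i
    induction i with
    | zero => rfl
    | succ i ih =>
      rw [Function.iterate_succ_apply', ih, hadd _ (hy i) _ (hz i),
        Function.iterate_succ_apply', Function.iterate_succ_apply']
  have hterm : ∀ m n, A^[m] (hser W c 0 n) = (lam ^ m)⁻¹ • hser W c m n := by
    intro m n
    cases hcn : c n with
    | none => simp [hser, hcn, hA0']
    | some j =>
      simp only [hser, hcn, hW]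
      rw [hsm _ _ (fun i => by rw [hAmV]; exact hVD _ _), hAmV, smul_smul]
      congr 1
      · rw [← zpow_natCast, ← zpow_neg, ← zpow_add₀ hlam0]
        congr 1; push_cast; ring
  have hserD : ∀ m n, hser W c m n ∈ D := by
    intro m n
    cases hcn : c n with
    | none => simp [hser, hcn]
    | some j =>
      simp only [hser, hcn, hW]
      exact D.smul_mem _ (hVD _ _)
  have htermD : ∀ n m, A^[m] (hser W c 0 n) ∈ D := fun n m => by
    rw [hterm]; exact D.smul_mem _ (hserD _ _)
  have hpart : ∀ J m, A^[m] (∑ n ∈ Finset.range J, hser W c 0 n) =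
      (lam ^ m)⁻¹ • ∑ n ∈ Finset.range J, hser W c m n := by
    intro J
    induction J with
    | zero => intro m; simp [hA0']
    | succ J ih =>
      intro m
      rw [Finset.sum_range_succ, had _ _ _ (htermD J), ih, hterm, ← smul_add,
        Finset.sum_range_succ]
      intro i
      rw [ih]
      exact D.smul_mem _ (D.sum_mem fun n _ => hserD _ _)
  set f : X := ∑' n, hser W c 0 n with hf
  have hmain : ∀ m l, c m = some l → (∀ i < m, A^[i] f ∈ D) ∧
      A^[m] f = (lam ^ m)⁻¹ • ∑' n, hser W c m n := by
    intro m l hm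
    refine hclosed m (by have := hc2 m l hm; omega)
      (fun J => ∑ n ∈ Finset.range J, hser W c 0 n) f _ ?_ ?_ ?_
    · intro J i _
      rw [hpart]
      exact D.smul_mem _ (D.sum_mem fun n _ => hserD _ _)
    · exact hS0.hasSum.tendsto_sum_nat
    · simp only [hpart]
      exact (hSm m l hm).hasSum.tendsto_sum_nat.const_smul _
  have hfD : ∀ i, A^[i] f ∈ D := by
    intro i
    obtain ⟨M, hM, hcard⟩ := hc3 0
    have hex : ∃ m, i < m ∧ c m = some 0 := by
      by_contra hcon
      push Not at hcon
      have a1 := hcard (M * (i + 1))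
      rw [Nat.mul_div_cancel_left _ hM] at a1
      have a2 : (Finset.Icc 1 (M * (i + 1))).filter (fun n => c n = some 0) ⊆ Finset.Icc 1 i := by
        intro n hn
        rw [Finset.mem_filter, Finset.mem_Icc] at hn
        rw [Finset.mem_Icc]
        refine ⟨hn.1.1, ?_⟩
        by_contra hlt
        exact hcon n (not_le.1 hlt) hn.2
      have a3 := Finset.card_le_card a2
      rw [Nat.card_Icc] at a3
      omega
    obtain ⟨m, him, hm⟩ := hex
    exact (hmain m 0 hm).1 i him
  have hT : ∀ m, (fun y => lam • A y)^[m] f = lam ^ m • A^[m] f := by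
    intro m
    induction m with
    | zero => simp
    | succ m ih =>
      rw [Function.iterate_succ_apply', ih]
      rw [hsmul _ _ (hfD m), Function.iterate_succ_apply', smul_smul, pow_succ']
  refine ⟨f, hfD 0, fun n _ => ?_, ?_⟩
  · rw [hT]; exact D.smul_mem _ (hfD n)
  · intro U hU hUne
    obtain ⟨i, hi⟩ := hdd U hU hUne
    obtain ⟨ε, hε, hball⟩ := Metric.isOpen_iff.1 hU _ hi
    obtain ⟨b, hb⟩ := exists_pow_lt_of_lt_one (show 0 < ε / 2 by positivity)
      (show (1 / 2 : ℝ) < 1 by norm_num)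
    have hxl : x (Nat.pair i b) = d i := by simp [hx]
    obtain ⟨M, hM, hcard⟩ := hc3 (Nat.pair i b)
    refine aux_density _ {n | c n = some (Nat.pair i b)} ?_ M hM ?_
    · intro m hm
      have hm : c m = some (Nat.pair i b) := hm
      show (fun y => lam • A y)^[m] f ∈ U
      rw [hT, (hmain m _ hm).2, smul_inv_smul₀ (pow_ne_zero _ hlam0)]
      apply hball
      rw [Metric.mem_ball, dist_eq_norm, ← hxl]
      have e1 := hbd m _ hm
      have e2 : (1 / 2 : ℝ) ^ Nat.pair i b ≤ (1 / 2) ^ b :=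
        pow_le_pow_of_le_one (by norm_num) (by norm_num) (Nat.right_le_pair i b)
      linarith
    · intro N
      refine (hcard N).trans (le_of_eq ?_)
      congr 1
      ext n
      simp only [Finset.mem_filter, Set.mem_ofPred_eq]
end

section
/- Let A be the densely defined linear operator on the complex Hilbert space ℓ²(ℕ) given by A(x_k)_{k≥0} = ((k+1) x_{k+1})_{k≥0} with domain D(A) = { x ∈ ℓ² : ((k+1) x_{k+1})_k ∈ ℓ² } (this is the differentiation operator f ↦ f′ on the Hardy space H² of the unit disc, under the identification of a function with its sequence of Taylor coefficients, with domain { f ∈ H² : f′ ∈ H² }). Then A is frequently hypercyclic. -/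
open Filter Topology
open scoped Classical

/-- The Hardy space `H²` of the unit disc, identified with `ℓ²(ℕ)` via Taylor
coefficients. -/
noncomputable abbrev H2 : Type := lp (fun _ : ℕ => ℂ) 2

/-- The domain `{f ∈ H² : f′ ∈ H²}` of the differentiation operator:
sequences `x` with `((k+1) x_{k+1})_k ∈ ℓ²`. -/
def DomD : Set H2 := {f | Memℓp (fun k : ℕ => ((k : ℂ) + 1) * f.1 (k + 1)) 2}

/-- The differentiation operator `f ↦ f′`, i.e. `(x_k)_k ↦ ((k+1) x_{k+1})_k`,
extended by `0` off its domain. -/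
noncomputable def Dop : H2 → H2 := fun f =>
  if h : f ∈ DomD then ⟨fun k => ((k : ℂ) + 1) * f.1 (k + 1), h⟩ else 0

namespace FHC

/-- block width -/
def w (j : ℕ) : ℕ := padicValNat 2 (j + 1) + 1

/-- block position -/
def t (j : ℕ) : ℕ := (∑ i ∈ Finset.range j, 2 * w i) + w j

lemma t_succ (j : ℕ) : t (j + 1) = t j + w j + w (j + 1) := by
  simp only [t, Finset.sum_range_succ]; ring

lemma t_sep {i j : ℕ} (h : i < j) : t i + w i + w j ≤ t j := by
  induction j with
  | zero => omega
  | succ j ih =>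
    rcases Nat.lt_succ_iff_lt_or_eq.mp h with h | h
    · have := ih h
      rw [t_succ]; omega
    · subst h; rw [t_succ]

lemma w_le_t (j : ℕ) : w j ≤ t j := by simp [t]

lemma one_le_w (j : ℕ) : 1 ≤ w j := by simp [w]

lemma t_strictMono : StrictMono t := by
  intro i j h
  have := t_sep h
  have := one_le_w i
  omega

lemma sum_w (j : ℕ) : ∑ i ∈ Finset.range j, w i = j + padicValNat 2 (j.factorial) := by
  induction j with
  | zero => simp
  | succ j ih =>
    rw [Finset.sum_range_succ, ih, Nat.factorial_succ,
      padicValNat.mul (by omega) (Nat.factorial_ne_zero j), w]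
    ring

lemma val_fact_le (j : ℕ) : padicValNat 2 (j.factorial) ≤ j := by
  have h := sub_one_mul_padicValNat_factorial (p := 2) j
  simp only [Nat.add_one_sub_one, one_mul] at h
  omega

lemma t_le (j : ℕ) : t j ≤ 4 * (j + 1) := by
  have h1 := sum_w (j + 1)
  have h2 := val_fact_le (j + 1)
  rw [Finset.sum_range_succ] at h1
  have : t j = 2 * (∑ i ∈ Finset.range j, w i) + w j := by
    simp only [t, Finset.mul_sum]
  omega

/-- block content -/
noncomputable def c (z : ℕ → ℕ → ℂ) (v k : ℕ) : ℂ :=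
  if ‖(k.factorial : ℂ) * z (Nat.unpair v).1 k‖ ≤ v
  then (k.factorial : ℂ) * z (Nat.unpair v).1 k else 0

lemma norm_c_le (z : ℕ → ℕ → ℂ) (v k : ℕ) : ‖c z v k‖ ≤ v := by
  unfold c
  split_ifs with h
  · exact h
  · simp

/-- the sequence -/
noncomputable def a (z : ℕ → ℕ → ℂ) (m : ℕ) : ℂ :=
  if h : ∃ j, t j ≤ m ∧ m < t j + w j then c z (w h.choose) (m - t h.choose) else 0

lemma a_cases (z : ℕ → ℕ → ℂ) (m : ℕ) :
    a z m = 0 ∨ ∃ j, t j ≤ m ∧ m < t j + w j ∧ a z m = c z (w j) (m - t j) := by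
  unfold a
  split_ifs with h
  · exact Or.inr ⟨h.choose, h.choose_spec.1, h.choose_spec.2, rfl⟩
  · exact Or.inl rfl

lemma a_block (z : ℕ → ℕ → ℂ) (j k : ℕ) (hk : k < w j) : a z (t j + k) = c z (w j) k := by
  have h : ∃ i, t i ≤ t j + k ∧ t j + k < t i + w i := ⟨j, by omega, by omega⟩
  have hj : h.choose = j := by
    have h1 := h.choose_spec
    rcases lt_trichotomy h.choose j with h2 | h2 | h2
    · have := t_sep h2
      omega
    · exact h2
    · have := t_sep h2
      omega
  unfold a
  rw [dif_pos h, hj]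
  congr 1
  omega

lemma norm_a_le (z : ℕ → ℕ → ℂ) (m : ℕ) : ‖a z m‖ ≤ m := by
  rcases a_cases z m with h | ⟨j, h1, h2, h⟩
  · simp [h]
  · rw [h]
    refine (norm_c_le _ _ _).trans ?_
    have := w_le_t j
    exact_mod_cast this.trans h1

lemma norm_a_tail (z : ℕ → ℕ → ℂ) (j k : ℕ) (hk : w j ≤ k) : ‖a z (t j + k)‖ ≤ k := by
  rcases a_cases z (t j + k) with h | ⟨i, h1, h2, h⟩
  · simp [h]
  · rw [h]
    refine (norm_c_le _ _ _).trans ?_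
    have : w i ≤ k := by
      rcases lt_trichotomy i j with h3 | h3 | h3
      · have := t_sep h3
        omega
      · subst h3; omega
      · have := t_sep h3
        omega
    exact_mod_cast this

lemma memF (z : ℕ → ℕ → ℂ) (n : ℕ) :
    Memℓp (fun k : ℕ => a z (n + k) / (k.factorial : ℂ)) 2 := by
  have h1 : Memℓp (fun k : ℕ => a z (n + k) / (k.factorial : ℂ)) 1 := by
    refine memℓp_gen ?_
    simp only [ENNReal.toReal_one, Real.rpow_one]
    refine Summable.of_nonneg_of_le (fun k => norm_nonneg _) (fun k => ?_)
      ((Real.summable_pow_div_factorial 2).mul_left ((n : ℝ) + 1))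
    rw [norm_div, Complex.norm_natCast, ← mul_div_assoc]
    gcongr
    refine (norm_a_le z _).trans ?_
    have h3 : k < 2 ^ k := Nat.lt_two_pow_self
    have h4 : (k : ℝ) + 1 ≤ 2 ^ k := by exact_mod_cast h3
    push_cast
    have : (0:ℝ) ≤ n := by positivity
    have : (0:ℝ) ≤ k := by positivity
    nlinarith
  exact h1.of_exponent_ge (by norm_num)

/-- the orbit -/
noncomputable def F (z : ℕ → ℕ → ℂ) (n : ℕ) : H2 := ⟨_, memF z n⟩

lemma F_apply (z : ℕ → ℕ → ℂ) (n k : ℕ) : (F z n).1 k = a z (n + k) / (k.factorial : ℂ) := rfl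

lemma F_eq (z : ℕ → ℕ → ℂ) (n : ℕ) :
    (fun k : ℕ => ((k : ℂ) + 1) * (F z n).1 (k + 1)) = (F z (n + 1)).1 := by
  funext k
  rw [F_apply, F_apply, Nat.factorial_succ]
  have h1 : ((k : ℂ) + 1) ≠ 0 := by exact_mod_cast Nat.succ_ne_zero k
  have h2 : (k.factorial : ℂ) ≠ 0 := by exact_mod_cast Nat.factorial_ne_zero k
  rw [show n + (k + 1) = n + 1 + k by ring]
  push_cast
  field_simp

lemma F_mem (z : ℕ → ℕ → ℂ) (n : ℕ) : F z n ∈ DomD := by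
  change Memℓp _ 2
  rw [F_eq]
  exact (F z (n + 1)).2

lemma Dop_F (z : ℕ → ℕ → ℂ) (n : ℕ) : Dop (F z n) = F z (n + 1) := by
  unfold Dop
  rw [dif_pos (F_mem z n)]
  apply Subtype.ext
  exact F_eq z n

lemma iter_F (z : ℕ → ℕ → ℂ) (n : ℕ) : Dop^[n] (F z 0) = F z n := by
  induction n with
  | zero => rfl
  | succ n ih => rw [Function.iterate_succ_apply', ih, Dop_F]

lemma summable_r : Summable fun k : ℕ => ((2:ℝ) ^ k / k.factorial) ^ 2 := by
  have h := Real.summable_pow_div_factorial 4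
  refine Summable.of_nonneg_of_le (fun k => by positivity) (fun k => ?_) h
  rw [div_pow, ← pow_mul, mul_comm k 2, pow_mul]
  norm_num
  have : (1:ℝ) ≤ k.factorial := by exact_mod_cast Nat.factorial_pos k
  gcongr
  nlinarith

lemma norm_le_tail (x : H2) (v : ℕ) (h0 : ∀ k < v, x.1 k = 0)
    (h1 : ∀ k, v ≤ k → ‖x.1 k‖ ≤ (2:ℝ) ^ k / k.factorial) :
    ‖x‖ ^ 2 ≤ ∑' k : ℕ, ((2:ℝ) ^ (k + v) / (k + v).factorial) ^ 2 := by
  have hs : Summable fun k : ℕ => ‖x.1 k‖ ^ 2 := by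
    have := (lp.memℓp x).summable (by norm_num)
    simpa using this
  have hn : ‖x‖ ^ 2 = ∑' k : ℕ, ‖x.1 k‖ ^ 2 := by
    have := lp.norm_rpow_eq_tsum (p := 2) (by norm_num) x
    simpa using this
  rw [hn, ← hs.sum_add_tsum_nat_add v, Finset.sum_eq_zero, zero_add]
  · refine Summable.tsum_le_tsum (fun k => ?_) ((summable_nat_add_iff v).2 hs)
      ((summable_nat_add_iff v).2 summable_r)
    gcongr
    exact h1 _ (by omega)
  · intro k hk
    rw [h0 k (Finset.mem_range.1 hk)]
    simp

lemma exists_dense : ∃ Z : ℕ → H2, DenseRange Z ∧ ∀ e, ∃ K, ∀ k, K ≤ k → (Z e).1 k = 0 := by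
  let E : (K : ℕ) → (Fin K → ℂ) → H2 := fun K x => ∑ i : Fin K, lp.single 2 (i : ℕ) (x i)
  have hE : ∀ K, Continuous (E K) := by
    intro K
    refine continuous_finset_sum _ fun i _ => ?_
    refine Continuous.comp (g := fun y : ℂ => (lp.single 2 (i : ℕ) y : H2)) ?_ (continuous_apply i)
    exact (lp.isometry_single (E := fun _ : ℕ => ℂ) (p := 2) (i : ℕ)).continuous
  refine ⟨fun e => E (Nat.unpair e).1 (TopologicalSpace.denseSeq _ (Nat.unpair e).2), ?_, ?_⟩
  · refine dense_iff_inter_open.2 ?_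
    rintro U hU ⟨y, hy⟩
    have h1 := (lp.hasSum_single (E := fun _ : ℕ => ℂ) (p := 2) (by norm_num) y).tendsto_sum_nat
    obtain ⟨K, hK⟩ := (h1.eventually (hU.mem_nhds hy)).exists
    have hK' : E K (fun i => y i) ∈ U := by
      have : E K (fun i => y i) = ∑ i ∈ Finset.range K, lp.single 2 i (y i) :=
        Fin.sum_univ_eq_sum_range (fun i => (lp.single 2 i (y i) : H2)) K
      rw [this]; exact hK
    obtain ⟨_, hx, ⟨i, rfl⟩⟩ := (TopologicalSpace.denseRange_denseSeq (Fin K → ℂ)).inter_open_nonempty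
      _ (hU.preimage (hE K)) ⟨_, hK'⟩
    exact ⟨_, by simpa using hx, ⟨Nat.pair K i, by
      change (fun p : ℕ × ℕ => E p.1 (TopologicalSpace.denseSeq (Fin p.1 → ℂ) p.2))
        (Nat.unpair (Nat.pair K i)) = _
      rw [Nat.unpair_pair]⟩⟩
  · intro e
    refine ⟨(Nat.unpair e).1, fun k hk => ?_⟩
    change ((E _ _ : H2) : ℕ → ℂ) k = 0
    simp only [E, lp.coeFn_sum, Finset.sum_apply]
    refine Finset.sum_eq_zero fun i _ => ?_
    have := i.2
    exact lp.single_apply_ne _ _ _ (by omega)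

lemma lowerDensity_pos (S : Set ℕ) (v : ℕ) (hS : ∀ j, w j = v + 1 → t j ∈ S) :
    0 < lowerDensity S := by
  have hpos : (0:ℝ) < 1 / 2 ^ (v + 4) := by positivity
  refine hpos.trans_le ?_
  unfold lowerDensity
  refine le_liminf_of_le ?_ ?_
  · refine Filter.IsBoundedUnder.isCoboundedUnder_ge ⟨1, ?_⟩
    rw [eventually_map]
    refine Eventually.of_forall fun N => ?_
    refine div_le_one_of_le₀ ?_ (by positivity)
    have := Finset.card_filter_le (Finset.Icc 1 N) (fun n => n ∈ S)
    rw [Nat.card_Icc] at this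
    exact_mod_cast this
  · filter_upwards [eventually_ge_atTop (2 ^ (v + 3))] with N hN
    have hp : 0 < 2 ^ (v + 3) := by positivity
    have hN0 : (0:ℝ) < N := by exact_mod_cast hp.trans_le hN
    have hcard : N / 2 ^ (v + 3) ≤ ((Finset.Icc 1 N).filter (fun n => n ∈ S)).card := by
      have hg : ∀ i, 2 ^ v * (2 * i + 1) - 1 + 1 = 2 ^ v * (2 * i + 1) := fun i =>
        Nat.sub_add_cancel (Nat.succ_le_of_lt (by positivity))
      have h := Finset.card_le_card_of_injOn (s := Finset.range (N / 2 ^ (v + 3)))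
        (t := (Finset.Icc 1 N).filter (fun n => n ∈ S))
        (fun i => t (2 ^ v * (2 * i + 1) - 1)) ?_ ?_
      · simpa using h
      · intro i hi
        have hi : i < N / 2 ^ (v + 3) := by simpa using hi
        have hi' : (i + 1) * 2 ^ (v + 3) ≤ N := (Nat.le_div_iff_mul_le hp).1 hi
        have ht := t_le (2 ^ v * (2 * i + 1) - 1)
        rw [hg] at ht
        have hw : w (2 ^ v * (2 * i + 1) - 1) = v + 1 := by
          unfold w
          rw [hg, padicValNat.mul (by positivity) (by omega), padicValNat.prime_pow,
            padicValNat.eq_zero_of_not_dvd (by omega)]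
        simp only [Finset.coe_filter, Finset.mem_Icc, Set.mem_setOf_eq]
        refine ⟨⟨(one_le_w _).trans (w_le_t _), ht.trans (le_trans ?_ hi')⟩, hS _ hw⟩
        have : 0 < 2 ^ v := by positivity
        rw [pow_add]
        nlinarith
      · intro i _ i' _ h
        have h := t_strictMono.injective h
        have h2 : 2 ^ v * (2 * i + 1) = 2 ^ v * (2 * i' + 1) := by
          rw [← hg i, ← hg i', h]
        have := Nat.eq_of_mul_eq_mul_left (by positivity) h2
        omega
    rw [le_div_iff₀ hN0]
    have h3 : N ≤ 2 * 2 ^ (v + 3) * (N / 2 ^ (v + 3)) := by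
      have h4 := Nat.div_add_mod N (2 ^ (v + 3))
      have h5 := Nat.mod_lt N hp
      have h6 : 1 ≤ N / 2 ^ (v + 3) := (Nat.one_le_div_iff hp).2 hN
      nlinarith
    have h4 : N ≤ 2 ^ (v + 4) * ((Finset.Icc 1 N).filter (fun n => n ∈ S)).card := by
      refine h3.trans ?_
      rw [show 2 ^ (v + 4) = 2 * 2 ^ (v + 3) by ring]
      gcongr
    rw [one_div, inv_mul_le_iff₀ (by positivity)]
    exact_mod_cast h4

end FHC

open FHC in
/-- The differentiation operator `D : f ↦ f′` on the dense linear
submanifold `{f ∈ H² : f′ ∈ H²}` of `H²` is frequently hypercyclic: there is `f` in the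
domain whose iterates all stay in the domain and whose orbit visits every non-empty open
set with positive lower density. -/
theorem stmt6 :
    ∃ f ∈ DomD, (∀ n : ℕ, 1 ≤ n → Dop^[n] f ∈ DomD) ∧
      ∀ U : Set H2, IsOpen U → U.Nonempty →
        0 < lowerDensity {n : ℕ | Dop^[n] f ∈ U} := by
  obtain ⟨Z, hZ, hsupp⟩ := exists_dense
  set z : ℕ → ℕ → ℂ := fun e k => (Z e).1 k with hz
  refine ⟨F z 0, F_mem z 0, fun n _ => by rw [iter_F]; exact F_mem z n, ?_⟩
  intro U hU hne
  obtain ⟨e, he⟩ := hZ.exists_mem_open hU hne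
  obtain ⟨K, hK⟩ := hsupp e
  obtain ⟨ε, hε, hball⟩ := Metric.isOpen_iff.1 hU _ he
  have htail := (tendsto_sum_nat_add fun k : ℕ => ((2:ℝ) ^ k / k.factorial) ^ 2)
  have hev := htail.eventually (gt_mem_nhds (show (0:ℝ) < ε ^ 2 by positivity))
  obtain ⟨V, hV⟩ := eventually_atTop.1 hev
  obtain ⟨B, hB⟩ := exists_nat_ge (∑ k ∈ Finset.range K, ‖(k.factorial : ℂ) * z e k‖)
  obtain ⟨v, hv1, hv2, hv3, hv4⟩ : ∃ v, V ≤ v + 1 ∧ K ≤ v + 1 ∧ B ≤ v + 1 ∧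
      (Nat.unpair (v + 1)).1 = e := by
    have h := Nat.right_le_pair e (V + K + B + 1)
    refine ⟨Nat.pair e (V + K + B + 1) - 1, by omega, by omega, by omega, ?_⟩
    rw [Nat.sub_add_cancel (by omega)]
    simp
  refine lowerDensity_pos _ v fun j hj => ?_
  change Dop^[t j] (F z 0) ∈ U
  rw [iter_F]
  apply hball
  rw [mem_ball_iff_norm]
  refine lt_of_pow_lt_pow_left₀ 2 hε.le (lt_of_le_of_lt ?_ (hV (v + 1) hv1))
  have hsub : ∀ k, (F z (t j) - Z e).1 k = (F z (t j)).1 k - (Z e).1 k := fun k => rfl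
  refine norm_le_tail _ _ ?_ ?_
  · intro k hk
    rw [hsub, F_apply, a_block z j k (by omega), hj, c, hv4]
    have hk0 : (k.factorial : ℂ) ≠ 0 := by exact_mod_cast Nat.factorial_ne_zero k
    rw [if_pos]
    · simp only [hz]
      field_simp
      ring
    · by_cases hkK : k < K
      · have h1 := Finset.single_le_sum (f := fun k => ‖(k.factorial : ℂ) * z e k‖)
          (fun i _ => norm_nonneg _) (Finset.mem_range.2 hkK)
        refine (h1.trans hB).trans ?_
        exact_mod_cast hv3
      · simp only [hz]
        rw [hK k (by omega)]
        simp only [mul_zero, norm_zero]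
        positivity
  · intro k hk
    rw [hsub, hK k (by omega), sub_zero, F_apply, norm_div, Complex.norm_natCast]
    gcongr
    refine (norm_a_tail z j k (by omega)).trans ?_
    exact_mod_cast (Nat.lt_two_pow_self (n := k)).le
end

section
/- Let X be the sequence space ℓ^p (1 ≤ p < ∞) or c₀ over ℝ or ℂ, let w be a scalar with |w| > 1, and let A be the weighted backward shift defined by A(x_k)_{k∈ℕ} = (w^k x_{k+1})_{k∈ℕ} with domain D(A) = { (x_k) ∈ X : (w^k x_{k+1})_k ∈ X }. Then A is frequently hypercyclic. -/
open Filter Topology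
open scoped ENNReal Classical

section WeightedShift

variable {𝕜 : Type*} [RCLike 𝕜]

/- Sequences are indexed by `k ∈ ℕ = {1, 2, 3, …}` in the paper; here we use `0`-based
indexing `y_j := x_{j+1}`, under which the weighted backward shift
`(A x)_k = w^k x_{k+1}` (`k ≥ 1`) becomes `(A y)_j = w^(j+1) y_{j+1}` (`j ≥ 0`). -/

/-- Domain of the weighted backward shift on `ℓ^p`. -/
def Dlp (w : 𝕜) (p : ℝ≥0∞) : Set (lp (fun _ : ℕ => 𝕜) p) :=
  {x | Memℓp (fun j : ℕ => w ^ (j + 1) * x.1 (j + 1)) p}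

/-- The weighted backward shift on `ℓ^p`, extended by `0` off its domain. -/
noncomputable def Alp (w : 𝕜) (p : ℝ≥0∞) :
    lp (fun _ : ℕ => 𝕜) p → lp (fun _ : ℕ => 𝕜) p := fun x =>
  if h : x ∈ Dlp w p then ⟨fun j => w ^ (j + 1) * x.1 (j + 1), h⟩ else 0

/-- Domain of the weighted backward shift on `c₀`. -/
def Dc0 (w : 𝕜) : Set (ZeroAtInftyContinuousMap ℕ 𝕜) :=
  {x | Tendsto (fun j : ℕ => w ^ (j + 1) * x (j + 1)) (cocompact ℕ) (𝓝 0)}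

/-- The weighted backward shift on `c₀`, extended by `0` off its domain. -/
noncomputable def Ac0 (w : 𝕜) :
    ZeroAtInftyContinuousMap ℕ 𝕜 → ZeroAtInftyContinuousMap ℕ 𝕜 := fun x =>
  if h : x ∈ Dc0 w then
    ⟨⟨fun j => w ^ (j + 1) * x (j + 1), continuous_of_discreteTopology⟩, by exact h⟩
  else 0

end WeightedShift

section Aux

/-- level of the index -/
def lev (i : ℕ) : ℕ := padicValNat 2 (i + 1)

/-- position of the index -/
def pos (i : ℕ) : ℕ := padicValNat 2 (i + 1).factorial + padicValNat 2 i.factorial + i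

lemma lev_fact (i : ℕ) : padicValNat 2 (i + 1).factorial = lev i + padicValNat 2 i.factorial := by
  rw [Nat.factorial_succ, padicValNat.mul (by omega) (Nat.factorial_ne_zero i), lev]

lemma val_fact_le (i : ℕ) : padicValNat 2 i.factorial ≤ i := by
  have := sub_one_mul_padicValNat_factorial (p := 2) i
  omega

lemma pos_le (i : ℕ) : pos i ≤ 3 * i + 1 := by
  have := val_fact_le i
  have := val_fact_le (i + 1)
  unfold pos; omega

lemma lev_le_pos (i : ℕ) : lev i ≤ pos i := by
  have := lev_fact i
  unfold pos; omega

lemma pos_succ (i : ℕ) : pos (i + 1) = pos i + lev i + lev (i + 1) + 1 := by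
  have := lev_fact i
  have := lev_fact (i + 1)
  unfold pos; omega

lemma pos_gap {i k : ℕ} (h : i < k) : pos i + lev i + lev k + 1 ≤ pos k := by
  induction k, h using Nat.le_induction with
  | base => rw [pos_succ]
  | succ k hk ih => rw [pos_succ]; omega

lemma pos_inj : Function.Injective pos := by
  intro i k h
  rcases lt_trichotomy i k with h1 | h1 | h1
  · have := pos_gap h1; omega
  · exact h1
  · have := pos_gap h1; omega

lemma lev_form (l c : ℕ) : lev (2 ^ l * (2 * c + 1) - 1) = l := by
  have h : 1 ≤ 2 ^ l * (2 * c + 1) := Nat.one_le_iff_ne_zero.mpr (by positivity)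
  unfold lev
  rw [Nat.sub_add_cancel h, padicValNat.mul (by positivity) (by omega), padicValNat.prime_pow,
    padicValNat.eq_zero_of_not_dvd (by omega)]
  rfl

lemma density_pos (S : Set ℕ) (l : ℕ) (h : ∀ i, lev i = l → pos i ∈ S) :
    0 < lowerDensity S := by
  set K : ℕ := 9 * 2 ^ l with hK
  have hKpos : 0 < K := by positivity
  have hcard : ∀ N : ℕ, N / K ≤ ((Finset.Icc 1 N).filter (fun n => n ∈ S)).card := by
    intro N
    have hinj : Set.InjOn (fun c : ℕ => pos (2 ^ l * (2 * c + 1) - 1))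
        (Finset.Icc 1 (N / K) : Finset ℕ) := by
      intro c _ d _ hcd
      have h1 := pos_inj hcd
      have hc : 1 ≤ 2 ^ l * (2 * c + 1) := Nat.one_le_iff_ne_zero.mpr (by positivity)
      have hd : 1 ≤ 2 ^ l * (2 * d + 1) := Nat.one_le_iff_ne_zero.mpr (by positivity)
      have h2 : 2 ^ l * (2 * c + 1) = 2 ^ l * (2 * d + 1) := by omega
      have h3 := Nat.eq_of_mul_eq_mul_left (by positivity) h2
      omega
    have := Finset.card_image_of_injOn hinj
    rw [Nat.card_Icc, Nat.add_sub_cancel] at this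
    rw [← this]
    apply Finset.card_le_card
    intro n hn
    rw [Finset.mem_image] at hn
    obtain ⟨c, hc, rfl⟩ := hn
    rw [Finset.mem_Icc] at hc
    have hpl := pos_le (2 ^ l * (2 * c + 1) - 1)
    have hc2 : c * K ≤ N := (Nat.le_div_iff_mul_le hKpos).1 hc.2
    have h2l : 1 ≤ 2 ^ l := Nat.one_le_two_pow
    have hge : 3 ≤ 2 ^ l * (2 * c + 1) := by nlinarith [hc.1]
    have hle : 2 ^ l * (2 * c + 1) * 3 ≤ c * K := by rw [hK]; nlinarith [hc.1]
    rw [Finset.mem_filter, Finset.mem_Icc]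
    refine ⟨⟨?_, by omega⟩, h _ (lev_form l c)⟩
    unfold pos; omega
  have key : (1 / (2 * K) : ℝ) ≤ lowerDensity S := by
    unfold lowerDensity
    apply le_liminf_of_le
    · apply Filter.IsCoboundedUnder.of_frequently_le (a := 1)
      apply Filter.Frequently.of_forall
      intro N
      apply div_le_one_of_le₀ _ (by positivity)
      have := Finset.card_filter_le (Finset.Icc 1 N) (fun n => n ∈ S)
      rw [Nat.card_Icc, Nat.add_sub_cancel] at this
      exact_mod_cast this
    · filter_upwards [eventually_ge_atTop K] with N hN
      have hNpos : 0 < N := by omega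
      have hN' : (0:ℝ) < N := by exact_mod_cast hNpos
      have hK' : (0:ℝ) < K := by exact_mod_cast hKpos
      have h1 : N ≤ 2 * K * (N / K) := by
        have h2 := Nat.div_add_mod N K
        have h3 := Nat.mod_lt N hKpos
        have h4 : 1 ≤ N / K := (Nat.one_le_div_iff hKpos).2 hN
        nlinarith
      have h2 : N ≤ 2 * K * ((Finset.Icc 1 N).filter (fun n => n ∈ S)).card :=
        h1.trans (Nat.mul_le_mul_left _ (hcard N))
      have h3 : (N:ℝ) ≤ 2 * K * (((Finset.Icc 1 N).filter (fun n => n ∈ S)).card : ℝ) := by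
        exact_mod_cast h2
      rw [div_le_div_iff₀ (by positivity) hN']
      linarith
  have hK' : (0:ℝ) < K := by exact_mod_cast hKpos
  exact lt_of_lt_of_le (by positivity) key

lemma fhc_of {X : Type*} [PseudoMetricSpace X] (D : Set X) (T : X → X) (F : ℕ → X)
    (hD : ∀ n, F n ∈ D) (hT : ∀ n, T (F n) = F (n + 1))
    (h : ∀ x : X, ∀ ε > 0, ∃ l, ∀ i, lev i = l → dist (F (pos i)) x < ε) :
    FreqHypercyclic D T := by
  have hit : ∀ n, T^[n] (F 0) = F n := by
    intro n
    induction n with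
    | zero => rfl
    | succ n ih => rw [Function.iterate_succ_apply', ih, hT]
  refine ⟨F 0, hD 0, fun n _ => by rw [hit]; exact hD n, ?_⟩
  rintro U hU ⟨x, hx⟩
  obtain ⟨ε, hε, hball⟩ := Metric.isOpen_iff.1 hU x hx
  obtain ⟨l, hl⟩ := h x ε hε
  apply density_pos _ l
  intro i hi
  show T^[pos i] (F 0) ∈ U
  rw [hit]
  exact hball (hl i hi)

variable {𝕜 : Type*} [RCLike 𝕜]

lemma exists_blocks (W : ℝ) (hW : 1 < W) : ∃ B : ℕ → ℕ → 𝕜,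
    (∀ l j, ‖B l j‖ ≤ W ^ l) ∧
    ∀ (x : ℕ → 𝕜) (m : ℕ) (ε : ℝ), 0 < ε → ∃ l, m ≤ l ∧ (∀ j < m, ‖B l j - x j‖ < ε) ∧
      ∀ j, m ≤ j → B l j = 0 := by
  obtain ⟨e, he⟩ := exists_surjective_nat (List ℕ)
  let u : ℕ → 𝕜 := TopologicalSpace.denseSeq 𝕜
  have hu : DenseRange u := TopologicalSpace.denseRange_denseSeq 𝕜
  let V : List ℕ → ℕ → 𝕜 := fun L j => (L[j]?).elim 0 u
  refine ⟨fun l j => if ‖V (e l.unpair.1) j‖ ≤ W ^ l then V (e l.unpair.1) j else 0, ?_, ?_⟩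
  · intro l j
    dsimp only
    split_ifs with h
    · exact h
    · rw [norm_zero]; positivity
  · intro x m ε hε
    have h1 : ∀ j, ∃ n, ‖u n - x j‖ < ε := by
      intro j
      obtain ⟨n, hn⟩ := hu.exists_dist_lt (x j) hε
      exact ⟨n, by rwa [dist_comm, dist_eq_norm] at hn⟩
    choose idx hidx using h1
    obtain ⟨k, hk⟩ := he ((List.range m).map idx)
    have hV1 : ∀ j < m, V (e k) j = u (idx j) := by
      intro j hj
      simp [V, hk, hj]
    have hV2 : ∀ j, m ≤ j → V (e k) j = 0 := by
      intro j hj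
      have : ((List.range m).map idx)[j]? = none := by simp [hj]
      simp only [V, hk, this, Option.elim]
    obtain ⟨b, hb⟩ := pow_unbounded_of_one_lt (∑ j ∈ Finset.range m, ‖V (e k) j‖) hW
    refine ⟨Nat.pair k (b + m), ?_, ?_, ?_⟩
    · have := Nat.right_le_pair k (b + m); omega
    · intro j hj
      dsimp only
      rw [Nat.unpair_pair, if_pos, hV1 j hj]
      · exact hidx j
      · calc ‖V (e k) j‖ ≤ ∑ j ∈ Finset.range m, ‖V (e k) j‖ :=
              Finset.single_le_sum (f := fun j => ‖V (e k) j‖) (fun _ _ => norm_nonneg _)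
                (Finset.mem_range.2 hj)
          _ ≤ W ^ b := hb.le
          _ ≤ _ := pow_le_pow_right₀ hW.le (by have := Nat.right_le_pair k (b + m); omega)
    · intro j hj
      dsimp only
      rw [Nat.unpair_pair, hV2 j hj, ite_self]

lemma exists_seq (W : ℝ) (hW : 1 < W) : ∃ z : ℕ → 𝕜,
    (∀ k, ‖z k‖ ≤ W ^ k) ∧
    ∀ (x : ℕ → 𝕜) (m : ℕ) (ε : ℝ), 0 < ε → ∃ l, ∀ i, lev i = l →
      (∀ j < m, ‖z (j + pos i) - x j‖ < ε) ∧
      ∀ j, m ≤ j → ‖z (j + pos i)‖ ≤ W ^ j := by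
  obtain ⟨B, hB1, hB2⟩ := exists_blocks (𝕜 := 𝕜) W hW
  let P : ℕ → ℕ → Prop := fun k i => pos i ≤ k ∧ k < pos i + lev i
  let z : ℕ → 𝕜 := fun k => if h : ∃ i, P k i then B (lev h.choose) (k - pos h.choose) else 0
  have huniq : ∀ k i i', P k i → P k i' → i = i' := by
    intro k i i' h h'
    rcases lt_trichotomy i i' with h1 | h1 | h1
    · have := pos_gap h1; have := h.2; have := h'.1; omega
    · exact h1
    · have := pos_gap h1; have := h'.2; have := h.1; omega
  have hz1 : ∀ k i, P k i → z k = B (lev i) (k - pos i) := by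
    intro k i h
    have hex : ∃ i, P k i := ⟨i, h⟩
    have : hex.choose = i := huniq k _ _ hex.choose_spec h
    simp only [z]
    rw [dif_pos hex, this]
  have hz0 : ∀ k, (¬ ∃ i, P k i) → z k = 0 := fun k h => dif_neg h
  refine ⟨z, ?_, ?_⟩
  · intro k
    by_cases h : ∃ i, P k i
    · obtain ⟨i, hi⟩ := h
      rw [hz1 k i hi]
      refine (hB1 _ _).trans (pow_le_pow_right₀ hW.le ?_)
      have := lev_le_pos i
      have := hi.1
      omega
    · rw [hz0 k h, norm_zero]; positivity
  · intro x m ε hε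
    obtain ⟨l, hml, hl1, hl2⟩ := hB2 x m ε hε
    refine ⟨l, fun i hi => ⟨?_, ?_⟩⟩
    · intro j hj
      rw [hz1 (j + pos i) i ⟨by omega, by omega⟩, hi, Nat.add_sub_cancel]
      exact hl1 j hj
    · intro j hj
      by_cases h : ∃ i', P (j + pos i) i'
      · obtain ⟨i', hi'⟩ := h
        rw [hz1 _ i' hi']
        rcases lt_trichotomy i i' with h1 | h1 | h1
        · have := pos_gap h1
          have := hi'.1
          exact (hB1 _ _).trans (pow_le_pow_right₀ hW.le (by omega))
        · subst h1
          rw [hi, Nat.add_sub_cancel, hl2 j hj, norm_zero]; positivity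
        · have := pos_gap h1
          have := hi'.2
          omega
      · rw [hz0 _ h, norm_zero]; positivity

/-- triangular numbers -/
def tri : ℕ → ℕ
  | 0 => 0
  | (j + 1) => tri j + (j + 1)

lemma two_mul_le_tri (j : ℕ) : 2 * j ≤ tri j + 3 := by
  have h : 2 * tri j = j * (j + 1) := by
    induction j with
    | zero => rfl
    | succ j ih => rw [tri]; linarith
  rcases Nat.lt_or_ge j 3 with h1 | h1
  · interval_cases j <;> omega
  · nlinarith

/-- dominating sequence -/
noncomputable def dom (W : ℝ) (j : ℕ) : ℝ := W ^ j / W ^ tri j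

lemma dom_nonneg {W : ℝ} (hW : 1 < W) (j : ℕ) : 0 ≤ dom W j := by
  unfold dom; positivity

lemma dom_le {W : ℝ} (hW : 1 < W) (j : ℕ) : dom W j ≤ W ^ 3 * W⁻¹ ^ j := by
  unfold dom
  have hW0 : 0 < W := by linarith
  rw [inv_pow, ← div_eq_mul_inv, div_le_div_iff₀ (by positivity) (by positivity), ← pow_add,
    ← pow_add]
  exact pow_le_pow_right₀ hW.le (by have := two_mul_le_tri j; omega)

lemma dom_summable {W : ℝ} (hW : 1 < W) : Summable (dom W) :=
  Summable.of_nonneg_of_le (dom_nonneg hW) (dom_le hW)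
    ((summable_geometric_of_lt_one (by positivity) (inv_lt_one_of_one_lt₀ hW)).mul_left _)

/-- orbit sequences -/
noncomputable def orb (w : 𝕜) (z : ℕ → 𝕜) (n j : ℕ) : 𝕜 := (w ^ tri j)⁻¹ * z (j + n)

lemma orb_succ (w : 𝕜) (hw : 1 < ‖w‖) (z : ℕ → 𝕜) (n j : ℕ) :
    w ^ (j + 1) * orb w z n (j + 1) = orb w z (n + 1) j := by
  have hw0 : w ≠ 0 := by rintro rfl; simp at hw; linarith
  unfold orb
  rw [tri, show j + 1 + n = j + (n + 1) by ring]
  field_simp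
  ring

lemma orb_norm_le (w : 𝕜) (hw : 1 < ‖w‖) (z : ℕ → 𝕜) (hz : ∀ k, ‖z k‖ ≤ ‖w‖ ^ k) (n j : ℕ) :
    ‖orb w z n j‖ ≤ ‖w‖ ^ n * dom ‖w‖ j := by
  unfold orb dom
  rw [norm_mul, norm_inv, norm_pow, ← mul_div_assoc, ← pow_add, div_eq_inv_mul, add_comm n j]
  exact mul_le_mul_of_nonneg_left (hz _) (by positivity)

lemma orb_summable (w : 𝕜) (hw : 1 < ‖w‖) (z : ℕ → 𝕜) (hz : ∀ k, ‖z k‖ ≤ ‖w‖ ^ k) (n : ℕ) :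
    Summable (fun j => ‖orb w z n j‖) :=
  Summable.of_nonneg_of_le (fun _ => norm_nonneg _) (orb_norm_le w hw z hz n)
    ((dom_summable hw).mul_left _)

/-- combined approximation -/
lemma exists_orb (w : 𝕜) (hw : 1 < ‖w‖) : ∃ z : ℕ → 𝕜,
    (∀ k, ‖z k‖ ≤ ‖w‖ ^ k) ∧
    ∀ (x : ℕ → 𝕜) (m : ℕ) (δ : ℝ), 0 < δ → ∃ l, ∀ i, lev i = l →
      (∀ j < m, ‖orb w z (pos i) j - x j‖ ≤ δ) ∧
      ∀ j, m ≤ j → ‖orb w z (pos i) j - x j‖ ≤ ‖x j‖ + dom ‖w‖ j := by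
  have hw0 : w ≠ 0 := by rintro rfl; simp at hw; linarith
  obtain ⟨z, hz, h⟩ := exists_seq (𝕜 := 𝕜) ‖w‖ hw
  refine ⟨z, hz, fun x m δ hδ => ?_⟩
  obtain ⟨l, hl⟩ := h (fun j => w ^ tri j * x j) m δ hδ
  refine ⟨l, fun i hi => ⟨fun j hj => ?_, fun j hj => ?_⟩⟩
  · have h1 := (hl i hi).1 j hj
    have h2 : orb w z (pos i) j - x j = (w ^ tri j)⁻¹ * (z (j + pos i) - w ^ tri j * x j) := by
      unfold orb; field_simp
    rw [h2, norm_mul, norm_inv, norm_pow]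
    have h3 : (‖w‖ ^ tri j)⁻¹ ≤ 1 := inv_le_one_of_one_le₀ (one_le_pow₀ hw.le)
    calc _ ≤ 1 * ‖z (j + pos i) - w ^ tri j * x j‖ :=
          mul_le_mul_of_nonneg_right h3 (norm_nonneg _)
      _ ≤ δ := by rw [one_mul]; exact h1.le
  · have h1 := (hl i hi).2 j hj
    refine (norm_sub_le _ _).trans ?_
    rw [add_comm]
    gcongr
    unfold orb dom
    rw [norm_mul, norm_inv, norm_pow, div_eq_inv_mul]
    exact mul_le_mul_of_nonneg_left h1 (by positivity)

lemma lp_small (p : ℝ≥0∞) [Fact (1 ≤ p)] (hp : p ≠ ∞) (b : ℕ → ℝ) (hb0 : ∀ j, 0 ≤ b j)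
    (hb : Memℓp b p) (ε : ℝ) (hε : 0 < ε) : ∃ (m : ℕ) (δ : ℝ), 0 < δ ∧
      ∀ y : lp (fun _ : ℕ => 𝕜) p, (∀ j < m, ‖y.1 j‖ ≤ δ) → (∀ j, m ≤ j → ‖y.1 j‖ ≤ b j) →
        ‖y‖ < ε := by
  have hp1 : (1 : ℝ≥0∞) ≤ p := Fact.out
  have hq : 0 < p.toReal := ENNReal.toReal_pos (by positivity) hp
  set q := p.toReal with hqdef
  have hs : Summable fun j => b j ^ q := by
    have := hb.summable hq
    simpa only [Real.norm_of_nonneg (hb0 _)] using this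
  have hεq : 0 < ε ^ q := Real.rpow_pos_of_pos hε q
  have ht := tendsto_sum_nat_add (fun j => b j ^ q)
  obtain ⟨m, hm⟩ := (ht.eventually (gt_mem_nhds (half_pos hεq))).exists
  have hc : 0 < ε ^ q / (2 * (m + 1)) := by positivity
  refine ⟨m, (ε ^ q / (2 * (m + 1))) ^ q⁻¹, Real.rpow_pos_of_pos hc _, fun y h1 h2 => ?_⟩
  have hys : Summable fun j => ‖y.1 j‖ ^ q := (lp.memℓp y).summable hq
  have hy := lp.norm_rpow_eq_tsum hq y
  have hsplit := hys.sum_add_tsum_nat_add m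
  have e1 : ∑ j ∈ Finset.range m, ‖y.1 j‖ ^ q ≤ ε ^ q / 2 := by
    calc ∑ j ∈ Finset.range m, ‖y.1 j‖ ^ q ≤ ∑ j ∈ Finset.range m, ε ^ q / (2 * (m + 1)) := by
          apply Finset.sum_le_sum
          intro j hj
          have := Real.rpow_le_rpow (norm_nonneg _) (h1 j (Finset.mem_range.1 hj)) hq.le
          rwa [Real.rpow_inv_rpow hc.le hq.ne'] at this
      _ = m * (ε ^ q / (2 * (m + 1))) := by simp
      _ ≤ ε ^ q / 2 := by
          rw [← mul_div_assoc, div_le_div_iff₀ (by positivity) (by positivity)]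
          nlinarith
  have e2 : ∑' j, ‖y.1 (j + m)‖ ^ q ≤ ∑' j, b (j + m) ^ q := by
    apply Summable.tsum_le_tsum
    · intro j
      exact Real.rpow_le_rpow (norm_nonneg _) (h2 _ (by omega)) hq.le
    · exact (summable_nat_add_iff m).2 hys
    · exact (summable_nat_add_iff m).2 hs
  have : ‖y‖ ^ q < ε ^ q := by
    rw [hy]
    change ∑' j, ‖y.1 j‖ ^ q < _
    rw [← hsplit]
    linarith
  exact lt_of_not_ge fun hge => absurd (Real.rpow_le_rpow hε.le hge hq.le) (not_le.2 this)

lemma memlp_of_summable {E : Type*} [NormedAddCommGroup E] (p : ℝ≥0∞) [Fact (1 ≤ p)] (f : ℕ → E)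
    (h : Summable fun j => ‖f j‖) : Memℓp f p := by
  have h1 : Memℓp f 1 := memℓp_gen (by simpa using h)
  exact h1.of_exponent_ge Fact.out

lemma fhc_lp (w : 𝕜) (hw : 1 < ‖w‖) (p : ℝ≥0∞) [Fact (1 ≤ p)] (hp : p ≠ ∞) :
    FreqHypercyclic (Dlp w p) (Alp w p) := by
  obtain ⟨z, hz, h⟩ := exists_orb w hw
  have hmem : ∀ n, Memℓp (orb w z n) p := fun n => memlp_of_summable p _ (orb_summable w hw z hz n)
  let F : ℕ → lp (fun _ : ℕ => 𝕜) p := fun n => ⟨orb w z n, hmem n⟩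
  have hst : ∀ n, (fun j => w ^ (j + 1) * (F n).1 (j + 1)) = orb w z (n + 1) :=
    fun n => funext fun j => orb_succ w hw z n j
  have hD : ∀ n, F n ∈ Dlp w p := by
    intro n
    show Memℓp (fun j => w ^ (j + 1) * (F n).1 (j + 1)) p
    rw [hst]; exact hmem _
  refine fhc_of _ _ F hD ?_ ?_
  · intro n
    unfold Alp
    rw [dif_pos (hD n)]
    exact Subtype.ext (hst n)
  · intro x ε hε
    have hb : Memℓp (fun j => ‖x.1 j‖ + dom ‖w‖ j) p := by
      have a1 : Memℓp (fun j => ‖x.1 j‖) p := (lp.memℓp x).norm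
      have a2 : Memℓp (fun j => dom ‖w‖ j) p :=
        memlp_of_summable p _ (by
          simpa only [Real.norm_of_nonneg (dom_nonneg hw _)] using dom_summable hw)
      exact a1.add a2
    obtain ⟨m, δ, hδ, hy⟩ := lp_small (𝕜 := 𝕜) p hp _
      (fun j => add_nonneg (norm_nonneg _) (dom_nonneg hw j)) hb ε hε
    obtain ⟨l, hl⟩ := h x.1 m δ hδ
    refine ⟨l, fun i hi => ?_⟩
    rw [dist_eq_norm]
    exact hy _ (hl i hi).1 (hl i hi).2

lemma fhc_c0 (w : 𝕜) (hw : 1 < ‖w‖) : FreqHypercyclic (Dc0 w) (Ac0 w) := by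
  obtain ⟨z, hz, h⟩ := exists_orb w hw
  have hcc : cocompact ℕ = atTop := by rw [cocompact_eq_cofinite, Nat.cofinite_eq_atTop]
  have hmem : ∀ n, Tendsto (orb w z n) (cocompact ℕ) (𝓝 0) := by
    intro n
    rw [hcc, tendsto_zero_iff_norm_tendsto_zero]
    exact (orb_summable w hw z hz n).tendsto_atTop_zero
  let F : ℕ → ZeroAtInftyContinuousMap ℕ 𝕜 :=
    fun n => ⟨⟨orb w z n, continuous_of_discreteTopology⟩, hmem n⟩
  have hst : ∀ n, (fun j => w ^ (j + 1) * (F n) (j + 1)) = orb w z (n + 1) :=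
    fun n => funext fun j => orb_succ w hw z n j
  have hD : ∀ n, F n ∈ Dc0 w := by
    intro n
    show Tendsto (fun j => w ^ (j + 1) * (F n) (j + 1)) (cocompact ℕ) (𝓝 0)
    rw [hst]; exact hmem _
  refine fhc_of _ _ F hD ?_ ?_
  · intro n
    unfold Ac0
    rw [dif_pos (hD n)]
    ext j
    exact orb_succ w hw z n j
  · intro x ε hε
    have hb : Tendsto (fun j => ‖x j‖ + dom ‖w‖ j) atTop (𝓝 0) := by
      have a1 : Tendsto (fun j => ‖x j‖) atTop (𝓝 0) := by
        rw [← tendsto_zero_iff_norm_tendsto_zero, ← hcc]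
        exact x.zero_at_infty'
      simpa using a1.add (dom_summable hw).tendsto_atTop_zero
    obtain ⟨m, hm⟩ := eventually_atTop.1 (hb.eventually (gt_mem_nhds (half_pos hε)))
    obtain ⟨l, hl⟩ := h x m (ε / 2) (half_pos hε)
    refine ⟨l, fun i hi => ?_⟩
    have hle : dist (F (pos i)) x ≤ ε / 2 := by
      rw [← ZeroAtInftyContinuousMap.dist_toBCF_eq_dist,
        BoundedContinuousFunction.dist_le (half_pos hε).le]
      intro j
      rw [dist_eq_norm]
      rcases Nat.lt_or_ge j m with hj | hj
      · exact (hl i hi).1 j hj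
      · exact ((hl i hi).2 j hj).trans (hm j hj).le
    linarith

end Aux

/-- Let `X` be `ℓ^p` (`1 ≤ p < ∞`) or `c₀` over `ℝ` or `ℂ` and let `w`
be a scalar with `|w| > 1`.  The weighted backward shift `A (x_k)_k = (w^k x_{k+1})_k`
with domain `D(A) = {x ∈ X : (w^k x_{k+1})_k ∈ X}` is frequently hypercyclic. -/
theorem stmt9 {𝕜 : Type*} [RCLike 𝕜] (w : 𝕜) (hw : 1 < ‖w‖)
    (p : ℝ≥0∞) [Fact (1 ≤ p)] (hp : p ≠ ∞) :
    FreqHypercyclic (Dlp w p) (Alp w p) ∧ FreqHypercyclic (Dc0 w) (Ac0 w) := by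
  exact ⟨fhc_lp w hw p hp, fhc_c0 w hw⟩
end

section
/- Let X be a separable Banach space, let C be a bounded injective linear operator on X with dense range, and let (W(t))_{t≥0} be a strongly continuous family of bounded linear operators on X satisfying W(0) = C and W(t)W(s) = C W(t+s) for all s, t ≥ 0 (a C-regularized semigroup). Let Z denote the set of all x ∈ X such that W(t)x ∈ Im(C) for all t ≥ 0 and the map t ↦ C⁻¹W(t)x is continuous. Suppose there is a set Y_0 ⊆ Z, dense in X, and a mapping S : Y_0 → Y_0 such that: (1) W(1)(S y) = C y for all y ∈ Y_0 (i.e., e^A S y = y where e^{tA} := C⁻¹W(t)); (2) ∑_{n=1}^∞ S^n y converges unconditionally for all y ∈ Y_0; (3) ∑_{n=1}^∞ C⁻¹W(n) y converges unconditionally for all y ∈ Y_0. Then there exists x ∈ Z such that for every non-empty open subset U of X the set { t ≥ 0 : C⁻¹W(t) x ∈ U } has positive lower density in [0, ∞), and the set { n ∈ ℕ : C⁻¹W(n) x ∈ U } has positive lower density in ℕ; that is, the operator e^A and the semigroup (e^{tA})_{t≥0} are frequently hypercyclic. -/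
open Filter Topology
open scoped Classical

/-- The lower density of a measurable set `M ⊆ ℝ₊`. -/
noncomputable def lowerDensityR (M : Set ℝ) : ℝ :=
  Filter.atTop.liminf fun N : ℕ =>
    (MeasureTheory.volume (M ∩ Set.Icc (0:ℝ) N)).toReal / (N : ℝ)

/-- Weight: 2-adic valuation plus one. -/
noncomputable def wt (r : ℕ) : ℕ := padicValNat 2 r + 1

/-- Partial sums of weights. -/
noncomputable def ptW (r : ℕ) : ℕ := ∑ i ∈ Finset.range r, wt i

/-- Positions. -/
noncomputable def posn (r : ℕ) : ℕ := ptW r + ptW (r + 1)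

lemma posn_sep {r s : ℕ} (h : r < s) : posn r + wt r + wt s ≤ posn s := by
  have mono : Monotone ptW := by
    intro a b hab
    exact Finset.sum_le_sum_of_subset (Finset.range_mono hab)
  have e1 : ptW (r+1) = ptW r + wt r := Finset.sum_range_succ _ _
  have e2 : ptW (s+1) = ptW s + wt s := Finset.sum_range_succ _ _
  have e3 : ptW (r+1) ≤ ptW s := mono h
  unfold posn
  omega

lemma wt_le_posn (r : ℕ) : wt r ≤ posn r := by
  have e1 : ptW (r+1) = ptW r + wt r := Finset.sum_range_succ _ _
  unfold posn
  omega

lemma ptW_eq (r : ℕ) : ptW (r + 1) = r + 1 + padicValNat 2 (Nat.factorial r) := by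
  induction r with
  | zero => simp [ptW, wt]
  | succ r ih =>
    have e1 : ptW (r+1+1) = ptW (r+1) + wt (r+1) := Finset.sum_range_succ _ _
    rw [e1, ih, Nat.factorial_succ, padicValNat.mul (by omega) (Nat.factorial_ne_zero r), wt]
    omega

lemma posn_le (r : ℕ) : posn r ≤ 4 * r + 2 := by
  have h := ptW_eq r
  have e1 : ptW (r+1) = ptW r + wt r := Finset.sum_range_succ _ _
  have h2 := sub_one_mul_padicValNat_factorial (p := 2) r
  unfold posn
  omega

/-- The universal separated sets. -/
def BS (v : ℕ) : Set ℕ := {n | ∃ r, r ≠ 0 ∧ padicValNat 2 r = v ∧ n = posn r}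

lemma BS_ge {v n : ℕ} (h : n ∈ BS v) : v + 1 ≤ n := by
  obtain ⟨r, -, rfl, rfl⟩ := h
  exact wt_le_posn r

lemma BS_sep {u v n m : ℕ} (hn : n ∈ BS u) (hm : m ∈ BS v) (h : n ≠ m) :
    n + u + v ≤ m ∨ m + u + v ≤ n := by
  obtain ⟨r, -, rfl, rfl⟩ := hn
  obtain ⟨s, -, rfl, rfl⟩ := hm
  rcases lt_trichotomy r s with h1 | h1 | h1
  · have := posn_sep h1
    unfold wt at this
    omega
  · subst h1; exact absurd rfl h
  · have := posn_sep h1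
    unfold wt at this
    omega

lemma BS_disj {u v n : ℕ} (hn : n ∈ BS u) (hm : n ∈ BS v) : u = v := by
  obtain ⟨r, -, rfl, rfl⟩ := hn
  obtain ⟨s, -, rfl, h⟩ := hm
  rcases lt_trichotomy r s with h1 | h1 | h1
  · have := posn_sep h1
    unfold wt at this
    omega
  · subst h1; rfl
  · have := posn_sep h1
    unfold wt at this
    omega

/-- Quantitative positive lower density. -/
def PosD (A : Set ℕ) : Prop :=
  ∃ c : ℝ, 0 < c ∧ ∀ᶠ N : ℕ in atTop, c * N ≤ ((Finset.Icc 1 N).filter (fun n => n ∈ A)).card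

lemma BS_posD (v : ℕ) : PosD (BS v) := by
  set q := 2 ^ v with hq
  have hq0 : 0 < q := by positivity
  refine ⟨1 / (16 * q), by positivity, ?_⟩
  filter_upwards [eventually_ge_atTop (8 * q)] with N hN
  have hinj : ∀ a b : ℕ, posn a = posn b → a = b := by
    intro r s h
    rcases lt_trichotomy r s with h1 | h1 | h1
    · have := posn_sep h1
      unfold wt at this
      omega
    · exact h1
    · have := posn_sep h1
      unfold wt at this
      omega
  have hcard : N / (8 * q) ≤ ((Finset.Icc 1 N).filter (fun n => n ∈ BS v)).card := by
    rw [← Finset.card_range (N / (8 * q))]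
    apply Finset.card_le_card_of_injOn (fun m => posn (q * (2 * m + 1)))
    · intro m hm
      simp only [Finset.coe_range, Set.mem_Iio] at hm
      simp only [Finset.coe_filter, Set.mem_ofPred_eq, Finset.mem_Icc]
      have h1 := posn_le (q * (2 * m + 1))
      have h2 := wt_le_posn (q * (2 * m + 1))
      refine ⟨⟨?_, ?_⟩, ?_⟩
      · unfold wt at h2; omega
      · have h3 : 8 * q * (m + 1) ≤ N := by
          calc 8 * q * (m+1) ≤ 8 * q * (N / (8 * q)) := Nat.mul_le_mul_left _ hm
            _ ≤ N := Nat.mul_div_le _ _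
        nlinarith
      · refine ⟨q * (2 * m + 1), by positivity, ?_, rfl⟩
        rw [padicValNat.mul (by omega) (by omega), hq, padicValNat.prime_pow,
          padicValNat.eq_zero_of_not_dvd (by omega)]
        rfl
    · intro a _ b _ h
      have := hinj _ _ h
      have := Nat.eq_of_mul_eq_mul_left hq0 this
      omega
  have hh : N ≤ 16 * q * (N / (8 * q)) := by
    have h1 := Nat.div_add_mod N (8 * q)
    have h2 := Nat.mod_lt N (show 8 * q > 0 by omega)
    have h3 : 1 ≤ N / (8 * q) := (Nat.one_le_div_iff (by omega)).2 hN
    nlinarith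
  have hh' : (N : ℝ) ≤ 16 * q * ((N / (8 * q) : ℕ) : ℝ) := by exact_mod_cast hh
  have hc' : ((N / (8 * q) : ℕ) : ℝ) ≤ ((Finset.Icc 1 N).filter (fun n => n ∈ BS v)).card := by
    exact_mod_cast hcard
  rw [div_mul_eq_mul_div, one_mul, div_le_iff₀ (by positivity)]
  calc (N : ℝ) ≤ 16 * q * ((N / (8 * q) : ℕ) : ℝ) := hh'
    _ ≤ 16 * q * ((Finset.Icc 1 N).filter (fun n => n ∈ BS v)).card := by gcongr
    _ = _ := by ring

lemma PosD.lowerDensity_pos {A B : Set ℕ} (hA : PosD A) (hAB : A ⊆ B) : 0 < lowerDensity B := by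
  obtain ⟨c, hc, h⟩ := hA
  refine lt_of_lt_of_le hc ?_
  unfold lowerDensity
  refine le_liminf_of_le ?_ ?_
  · apply IsBoundedUnder.isCoboundedUnder_ge
    refine ⟨1, ?_⟩
    rw [eventually_map]
    refine Eventually.of_forall fun N => ?_
    apply div_le_one_of_le₀ _ (by positivity)
    have := Finset.card_filter_le (Finset.Icc 1 N) (fun n => n ∈ B)
    rw [Nat.card_Icc] at this
    exact_mod_cast this
  · filter_upwards [h, eventually_gt_atTop 0] with N hN hN0
    rw [le_div_iff₀ (by positivity)]
    refine hN.trans ?_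
    have : ((Finset.Icc 1 N).filter (fun n => n ∈ A)).card ≤
        ((Finset.Icc 1 N).filter (fun n => n ∈ B)).card :=
      Finset.card_le_card (Finset.monotone_filter_right _ fun n _ hn => hAB hn)
    exact_mod_cast this

lemma PosD.lowerDensityR_pos {A : Set ℕ} {M : Set ℝ} {δ : ℝ} (hA : PosD A) (hδ : 0 < δ)
    (hδ1 : δ ≤ 1) (hAM : ∀ k ∈ A, ∀ t : ℝ, (k : ℝ) ≤ t → t < k + δ → t ∈ M) :
    0 < lowerDensityR M := by
  obtain ⟨c, hc, h⟩ := hA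
  have hpos : 0 < δ * (c / 2) := by positivity
  refine lt_of_lt_of_le hpos ?_
  unfold lowerDensityR
  refine le_liminf_of_le ?_ ?_
  · apply IsBoundedUnder.isCoboundedUnder_ge
    refine ⟨1, ?_⟩
    rw [eventually_map]
    refine Eventually.of_forall fun N => ?_
    apply div_le_one_of_le₀ _ (by positivity)
    apply ENNReal.toReal_le_of_le_ofReal (by positivity)
    refine (MeasureTheory.measure_mono Set.inter_subset_right).trans ?_
    rw [Real.volume_Icc, sub_zero]
  · filter_upwards [(tendsto_sub_atTop_nat 1).eventually h, eventually_ge_atTop 2] with N hN hN2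
    set F := (Finset.Icc 1 (N - 1)).filter (fun n => n ∈ A) with hF
    have hsub : (⋃ k ∈ F, Set.Ico (k : ℝ) (k + δ)) ⊆ M ∩ Set.Icc (0:ℝ) N := by
      intro t ht
      simp only [Set.mem_iUnion, Set.mem_Ico] at ht
      obtain ⟨k, hk, hk1, hk2⟩ := ht
      rw [hF, Finset.mem_filter, Finset.mem_Icc] at hk
      refine ⟨hAM k hk.2 t hk1 hk2, le_trans (by positivity) hk1, ?_⟩
      have : ((k + 1 : ℕ) : ℝ) ≤ N := by
        have : k + 1 ≤ N := by omega
        exact_mod_cast this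
      push_cast at this
      linarith
    have hvol : MeasureTheory.volume (⋃ k ∈ F, Set.Ico (k : ℝ) (k + δ)) =
        ENNReal.ofReal (F.card * δ) := by
      rw [MeasureTheory.measure_biUnion_finset]
      · simp only [Real.volume_Ico, add_sub_cancel_left, Finset.sum_const, nsmul_eq_mul]
        rw [ENNReal.ofReal_mul (by positivity), ENNReal.ofReal_natCast]
      · intro a _ b _ hab
        rw [Function.onFun, Set.disjoint_left]
        rintro t ⟨h1, h2⟩ ⟨h3, h4⟩
        apply hab
        have e1 : (a : ℝ) < (b + 1 : ℕ) := by push_cast; linarith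
        have e2 : (b : ℝ) < (a + 1 : ℕ) := by push_cast; linarith
        have e1' := Nat.cast_lt.1 e1
        have e2' := Nat.cast_lt.1 e2
        omega
      · intro k _
        exact measurableSet_Ico
    have hfin : MeasureTheory.volume (M ∩ Set.Icc (0:ℝ) N) ≠ ⊤ := by
      refine ne_top_of_le_ne_top ?_ (MeasureTheory.measure_mono Set.inter_subset_right)
      rw [Real.volume_Icc]
      exact ENNReal.ofReal_ne_top
    have key : F.card * δ ≤ (MeasureTheory.volume (M ∩ Set.Icc (0:ℝ) N)).toReal := by
      rw [← ENNReal.ofReal_le_iff_le_toReal hfin, ← hvol]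
      exact MeasureTheory.measure_mono hsub
    have hNpos : (2 : ℝ) ≤ N := by exact_mod_cast hN2
    rw [le_div_iff₀ (by linarith)]
    refine le_trans ?_ key
    rw [Nat.cast_sub (by omega)] at hN
    push_cast at hN
    have h5 : c / 2 * N ≤ c * (N - 1) := by nlinarith
    nlinarith


lemma UncondConv.summable_indicator {X : Type*} [NormedAddCommGroup X] [CompleteSpace X]
    {z : ℕ → X} (hz : UncondConv z) (E : Set ℕ) : Summable (E.indicator z) := by
  rw [summable_iff_vanishing_norm]
  intro ε hε
  obtain ⟨N, -, hN⟩ := hz ε hε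
  refine ⟨Finset.range (N + 1), fun t ht => ?_⟩
  have : ∑ i ∈ t, E.indicator z i = ∑ i ∈ t.filter (fun i => i ∈ E), z i := by
    rw [Finset.sum_filter]
    rfl
  rw [this]
  apply hN
  intro k hk
  have := Finset.disjoint_left.1 ht (Finset.mem_filter.1 hk).1
  rw [Finset.mem_range] at this
  omega

lemma norm_tsum_indicator_le {X : Type*} [NormedAddCommGroup X] [CompleteSpace X]
    {z : ℕ → X} (hz : UncondConv z) (E : Set ℕ) {K : ℕ} {ε : ℝ} (hE : ∀ n ∈ E, K ≤ n)
    (hK : ∀ F : Finset ℕ, (∀ k ∈ F, K ≤ k) → ‖∑ k ∈ F, z k‖ ≤ ε) :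
    ‖∑' n, E.indicator z n‖ ≤ ε := by
  refine le_of_tendsto (hz.summable_indicator E).hasSum.norm (Eventually.of_forall fun F => ?_)
  have : ∑ i ∈ F, E.indicator z i = ∑ i ∈ F.filter (fun i => i ∈ E), z i := by
    rw [Finset.sum_filter]
    rfl
  rw [this]
  apply hK
  intro k hk
  exact hE k (Finset.mem_filter.1 hk).2

set_option maxHeartbeats 1000000 in
/-- One-level lemma: apply `V` (playing the role of `W k`) to `∑_{n ∈ A} S^n y`. -/
lemma level {𝕜 X : Type*} [RCLike 𝕜] [NormedAddCommGroup X] [NormedSpace 𝕜 X]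
    [CompleteSpace X] (C V : X →L[𝕜] X) (p q : ℕ → X) (hp : UncondConv p) (hq : UncondConv q)
    (k : ℕ) (hV1 : ∀ e, V (p (k + e)) = C (p e))
    (hV2 : ∀ n, n < k → V (p n) = C (q (k - n)))
    (A : Set ℕ) (K : ℕ) (ε : ℝ)
    (hA : ∀ n ∈ A, n ≠ k → n + K ≤ k ∨ k + K ≤ n)
    (hKp : ∀ F : Finset ℕ, (∀ k ∈ F, K ≤ k) → ‖∑ k ∈ F, p k‖ ≤ ε)
    (hKq : ∀ F : Finset ℕ, (∀ k ∈ F, K ≤ k) → ‖∑ k ∈ F, q k‖ ≤ ε) :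
    ∃ g, V (∑' n, A.indicator p n) = C g ∧ ‖g - (if k ∈ A then p 0 else 0)‖ ≤ 2 * ε := by
  -- the forward part
  set E1 : Set ℕ := {e | 0 < e ∧ k + e ∈ A} with hE1
  set E2 : Set ℕ := {d | 0 < d ∧ d ≤ k ∧ k - d ∈ A} with hE2
  have hs := (hp.summable_indicator A)
  have b1 : ‖∑' n, E1.indicator p n‖ ≤ ε := by
    apply norm_tsum_indicator_le hp E1 _ hKp
    rintro n ⟨hn0, hn⟩
    have := hA _ hn (by omega)
    omega
  have b2 : ‖∑' n, E2.indicator q n‖ ≤ ε := by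
    apply norm_tsum_indicator_le hq E2 _ hKq
    rintro n ⟨hn0, hnk, hn⟩
    have := hA _ hn (by omega)
    omega
  refine ⟨∑' n, E1.indicator p n + ∑' n, E2.indicator q n + (if k ∈ A then p 0 else 0), ?_, ?_⟩
  · have e2 : ∑' n, E2.indicator q n = ∑ n ∈ Finset.range k, if n ∈ A then q (k - n) else 0 := by
      rw [tsum_eq_sum (s := Finset.range (k+1))]
      · rw [Finset.sum_range_succ', ← Finset.sum_range_reflect]
        have : E2.indicator q 0 = 0 := by
          apply Set.indicator_of_notMem
          rintro ⟨h, -⟩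
          omega
        rw [this, add_zero]
        apply Finset.sum_congr rfl
        intro n hn
        rw [Finset.mem_range] at hn
        have h3 : k - 1 - n + 1 = k - n := by omega
        rw [h3]
        have h4 : k - n ∈ E2 ↔ n ∈ A := by
          have h5 : k - (k - n) = n := by omega
          rw [hE2]
          constructor
          · rintro ⟨-, -, h⟩
            rwa [h5] at h
          · intro h
            refine ⟨by omega, by omega, ?_⟩
            rwa [h5]
        by_cases h : n ∈ A
        · rw [if_pos h, Set.indicator_of_mem (h4.2 h)]
        · rw [if_neg h, Set.indicator_of_notMem (fun h' => h (h4.1 h'))]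
      · intro b hb
        apply Set.indicator_of_notMem
        rintro ⟨-, h, -⟩
        rw [Finset.mem_range] at hb
        omega
    have e1 : ∑' e, A.indicator p (e + k) = A.indicator p (0 + k) + ∑' e, A.indicator p (e + 1 + k) :=
      ((summable_nat_add_iff k).2 hs).tsum_eq_zero_add
    have e3 : ∑' e, E1.indicator p e = ∑' e, E1.indicator p (e + 1) := by
      rw [(hp.summable_indicator E1).tsum_eq_zero_add]
      have : E1.indicator p 0 = 0 := by
        apply Set.indicator_of_notMem
        rintro ⟨h, -⟩
        omega
      rw [this, zero_add]
    rw [← hs.sum_add_tsum_nat_add k, e1, map_add, map_add, map_sum, e2, e3, map_add, map_add,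
      map_sum]
    have f1 : ∑ n ∈ Finset.range k, V (A.indicator p n) =
        ∑ n ∈ Finset.range k, C (if n ∈ A then q (k - n) else 0) := by
      apply Finset.sum_congr rfl
      intro n hn
      rw [Finset.mem_range] at hn
      by_cases h : n ∈ A
      · rw [if_pos h, Set.indicator_of_mem h, hV2 n hn]
      · rw [if_neg h, Set.indicator_of_notMem h, map_zero, map_zero]
    have f2 : V (A.indicator p (0 + k)) = C (if k ∈ A then p 0 else 0) := by
      rw [zero_add]
      by_cases h : k ∈ A
      · rw [if_pos h, Set.indicator_of_mem h]
        exact hV1 0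
      · rw [if_neg h, Set.indicator_of_notMem h, map_zero, map_zero]
    have f3 : V (∑' e, A.indicator p (e + 1 + k)) = C (∑' e, E1.indicator p (e + 1)) := by
      rw [V.map_tsum, C.map_tsum]
      · apply tsum_congr
        intro e
        have h4 : e + 1 ∈ E1 ↔ e + 1 + k ∈ A := by
          rw [hE1, add_comm (e+1) k]
          exact ⟨fun h => h.2, fun h => ⟨by omega, h⟩⟩
        by_cases h : e + 1 + k ∈ A
        · rw [Set.indicator_of_mem h, Set.indicator_of_mem (h4.2 h), add_comm (e+1) k]
          exact hV1 _
        · rw [Set.indicator_of_notMem h, Set.indicator_of_notMem (fun h' => h (h4.1 h')),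
            map_zero, map_zero]
      · exact (summable_nat_add_iff 1).2 (hp.summable_indicator E1)
      · exact (summable_nat_add_iff 1).2 ((summable_nat_add_iff k).2 hs)
    rw [f1, f2, f3]
    abel
  · rw [add_sub_cancel_right]
    refine (norm_add_le _ _).trans ?_
    linarith

lemma UncondConv.eventually_tail {X : Type*} [NormedAddCommGroup X]
    {z : ℕ → X} (hz : UncondConv z) {ε : ℝ} (hε : 0 < ε) : ∀ᶠ K : ℕ in atTop,
      ∀ F : Finset ℕ, (∀ k ∈ F, K ≤ k) → ‖∑ k ∈ F, z k‖ ≤ ε := by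
  obtain ⟨N, -, hN⟩ := hz ε hε
  filter_upwards [eventually_gt_atTop N] with K hK F hF
  exact (hN F fun k hk => lt_of_lt_of_le hK (hF k hk)).le

/-- Discrete core. -/
lemma core {𝕜 X : Type*} [RCLike 𝕜] [NormedAddCommGroup X] [NormedSpace 𝕜 X]
    [CompleteSpace X] (C : X →L[𝕜] X) (V : ℕ → X →L[𝕜] X) (p q : ℕ → ℕ → X)
    (hp : ∀ j, UncondConv (p j)) (hq : ∀ j, UncondConv (q j))
    (hV1 : ∀ j k e, V k (p j (k + e)) = C (p j e))
    (hV2 : ∀ j k n, n < k → V k (p j n) = C (q j (k - n))) :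
    ∃ x : X, ∃ A : ℕ → Set ℕ, (∀ l, PosD (A l)) ∧ ∀ l, ∀ k ∈ A l, ∃ g, V k x = C g ∧
      ‖g - p l 0‖ ≤ 4 * (1/2)^l := by
  obtain ⟨N, hNm, hN⟩ := extraction_forall_of_eventually (P := fun m K => ∀ j ∈ Finset.range (m+1),
      (∀ F : Finset ℕ, (∀ k ∈ F, K ≤ k) → ‖∑ k ∈ F, p j k‖ ≤ (1/4)^m) ∧
      (∀ F : Finset ℕ, (∀ k ∈ F, K ≤ k) → ‖∑ k ∈ F, q j k‖ ≤ (1/4)^m)) (by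
    intro m
    rw [eventually_all_finset]
    intro j _
    exact ((hp j).eventually_tail (by positivity)).and ((hq j).eventually_tail (by positivity)))
  set A : ℕ → Set ℕ := fun l => BS (N l) with hA
  set X0 : ℕ → X := fun j => ∑' n, (A j).indicator (p j) n with hX0
  have bX0 : ∀ j, ‖X0 j‖ ≤ (1/4)^j := by
    intro j
    refine norm_tsum_indicator_le (hp j) (A j) (K := N j) ?_ (hN j j (by simp)).1
    intro n hn
    have := BS_ge hn
    omega
  have sX0 : Summable X0 :=
    Summable.of_norm_bounded (summable_geometric_of_lt_one (by norm_num) (by norm_num)) bX0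
  refine ⟨∑' j, X0 j, A, fun l => BS_posD _, ?_⟩
  intro l k hk
  have lev : ∀ j, ∃ g, V k (X0 j) = C g ∧
      ‖g - (if j = l then p l 0 else 0)‖ ≤ 2 * (1/2)^l * (1/2)^j := by
    intro j
    set m := max l j with hm
    obtain ⟨g, hg1, hg2⟩ := level C (V k) (p j) (q j) (hp j) (hq j) k (hV1 j k) (hV2 j k) (A j)
      (N m) ((1/4)^m) (by
        intro n hn hnk
        have h1 := BS_sep hn hk hnk
        have h2 : N m ≤ N l + N j := by
          rcases le_total l j with h | h
          · rw [hm, max_eq_right h]; omega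
          · rw [hm, max_eq_left h]; omega
        omega) (hN m j (by simp [hm])).1 (hN m j (by simp [hm])).2
    refine ⟨g, hg1, ?_⟩
    have h3 : (if k ∈ A j then p j 0 else 0) = (if j = l then p l 0 else 0) := by
      by_cases h : j = l
      · subst h; rw [if_pos hk, if_pos rfl]
      · rw [if_neg h, if_neg]
        intro h'
        exact h (hNm.injective (BS_disj h' hk))
    rw [h3] at hg2
    refine hg2.trans ?_
    have h4 : ((1:ℝ)/4)^m ≤ (1/2)^l * (1/2)^j := by
      have : ((1:ℝ)/4)^m = (1/2)^m * (1/2)^m := by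
        rw [← mul_pow]; norm_num
      rw [this]
      apply mul_le_mul _ _ (by positivity) (by positivity)
      · exact pow_le_pow_of_le_one (by norm_num) (by norm_num) (le_max_left _ _)
      · exact pow_le_pow_of_le_one (by norm_num) (by norm_num) (le_max_right _ _)
    linarith
  choose g hg1 hg2 using lev
  have sb : HasSum (fun j : ℕ => 2 * (1/2:ℝ)^l * (1/2)^j) (2 * (1/2:ℝ)^l * 2) :=
    hasSum_geometric_two.mul_left _
  have sd : Summable (fun j => g j - (if j = l then p l 0 else 0)) :=
    Summable.of_norm_bounded sb.summable hg2
  have si : HasSum (fun j => (if j = l then p l 0 else 0)) (p l 0) := hasSum_ite_eq l _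
  have sg : Summable g := by
    have := sd.add si.summable
    simpa using this
  refine ⟨∑' j, g j, ?_, ?_⟩
  · rw [(V k).map_tsum sX0, C.map_tsum sg]
    exact tsum_congr hg1
  · have : ∑' j, g j - p l 0 = ∑' j, (g j - (if j = l then p l 0 else 0)) := by
      rw [sg.tsum_sub si.summable, si.tsum_eq]
    rw [this]
    refine (tsum_of_norm_bounded sb hg2).trans ?_
    linarith

/-- Let `X` be a separable Banach space, `C` a bounded injective
operator with dense range, and `(W(t))_{t≥0}` a strongly continuous `C`-regularized
semigroup (`W(0) = C`, `W(t)W(s) = C W(t+s)`).  `Cinv` denotes the inverse of `C` on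
`Im(C)` (any left inverse of `C`), `Z` is the solution space.  If there is a dense set
`Y₀ ⊆ Z` and `S : Y₀ → Y₀` with `W(1) S y = C y`, and `∑ S^n y`, `∑ C⁻¹W(n) y`
unconditionally convergent for `y ∈ Y₀`, then there is `x ∈ Z` whose orbits
`t ↦ C⁻¹W(t)x` and `n ↦ C⁻¹W(n)x` visit every non-empty open set with positive lower
density: the operator `e^A` and the semigroup `(e^{tA})_{t≥0}` are frequently
hypercyclic. -/
theorem stmt13 {𝕜 X : Type*} [RCLike 𝕜] [NormedAddCommGroup X] [NormedSpace 𝕜 X]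
    [CompleteSpace X] [TopologicalSpace.SeparableSpace X]
    (C : X →L[𝕜] X) (hCinj : Function.Injective C) (hCdense : DenseRange C)
    (W : ℝ → X →L[𝕜] X)
    (hW0 : W 0 = C)
    (hWsg : ∀ s ≥ (0:ℝ), ∀ t ≥ (0:ℝ), ∀ x : X, W t (W s x) = C (W (t + s) x))
    (hWcont : ∀ x : X, ContinuousOn (fun t => W t x) (Set.Ici (0:ℝ)))
    -- `Cinv` is the inverse of `C` on `Im(C)`
    (Cinv : X → X) (hCinv : ∀ y : X, Cinv (C y) = y)
    -- the solution space `Z`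
    (Z : Set X)
    (hZ : Z = {x : X | (∀ t ≥ (0:ℝ), W t x ∈ Set.range C) ∧
      ContinuousOn (fun t => Cinv (W t x)) (Set.Ici (0:ℝ))})
    -- the dense subset `Y₀ ⊆ Z` and the map `S : Y₀ → Y₀`
    (Y₀ : Set X) (hY₀Z : Y₀ ⊆ Z) (hY₀dense : Dense Y₀)
    (S : X → X) (hS : ∀ y ∈ Y₀, S y ∈ Y₀)
    -- (1) `e^A S y = y`, i.e. `W(1)(S y) = C y`
    (h1 : ∀ y ∈ Y₀, W 1 (S y) = C y)
    -- (2) `∑ₙ S^n y` converges unconditionally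
    (h2 : ∀ y ∈ Y₀, UncondConv fun n => S^[n] y)
    -- (3) `∑ₙ e^{nA} y = ∑ₙ C⁻¹ W(n) y` converges unconditionally
    (h3 : ∀ y ∈ Y₀, UncondConv fun n => Cinv (W (n : ℝ) y)) :
    ∃ x ∈ Z, ∀ U : Set X, IsOpen U → U.Nonempty →
      0 < lowerDensityR {t : ℝ | 0 ≤ t ∧ Cinv (W t x) ∈ U} ∧
      0 < lowerDensity {n : ℕ | Cinv (W (n : ℝ) x) ∈ U} := by
  have : SecondCountableTopology X := UniformSpace.secondCountable_of_separable X
  have : Nonempty Y₀ := hY₀dense.nonempty.to_subtype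
  obtain ⟨u, hu⟩ := TopologicalSpace.exists_dense_seq Y₀
  have hu' : DenseRange (fun i => (u i : X)) := hY₀dense.denseRange_val.comp hu continuous_subtype_val
  set y : ℕ → X := fun l => u (Nat.unpair l).1 with hy
  have hyY : ∀ l, y l ∈ Y₀ := fun l => (u _).2
  have hWC : ∀ t ≥ (0:ℝ), ∀ z, W t (C z) = C (W t z) := by
    intro t ht z
    have := hWsg 0 le_rfl t ht z
    rwa [hW0, add_zero] at this
  have hCC : ∀ z ∈ Set.range C, C (Cinv z) = z := by
    rintro _ ⟨w, rfl⟩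
    rw [hCinv]
  have hSit : ∀ n, ∀ z ∈ Y₀, S^[n] z ∈ Y₀ := by
    intro n
    induction n with
    | zero => intro z hz; exact hz
    | succ n ih => intro z hz; exact ih _ (hS z hz)
  have hWS : ∀ n : ℕ, ∀ z ∈ Y₀, W (n : ℝ) (S^[n] z) = C z := by
    intro n
    induction n with
    | zero => intro z _; simp [hW0]
    | succ n ih =>
      intro z hz
      apply hCinj
      have h := hWsg 1 zero_le_one (n : ℝ) (Nat.cast_nonneg n) (S^[n+1] z)
      rw [Nat.cast_succ, ← h, Function.iterate_succ_apply', h1 _ (hSit n z hz),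
        hWC _ (Nat.cast_nonneg n), ih z hz]
  obtain ⟨x, A, hA, hx⟩ := core C (fun k : ℕ => W (k : ℝ)) (fun j n => S^[n] (y j))
    (fun j n => Cinv (W (n : ℝ) (y j))) (fun j => h2 _ (hyY j)) (fun j => h3 _ (hyY j))
    (by
      intro j k e
      simp only [Function.iterate_add_apply]
      exact hWS k _ (hSit e _ (hyY j)))
    (by
      intro j k n hnk
      have hz := hY₀Z (hyY j)
      rw [hZ] at hz
      rw [hCC _ (hz.1 _ (Nat.cast_nonneg _))]
      apply hCinj
      have h := hWsg n (Nat.cast_nonneg n) ((k - n : ℕ) : ℝ) (Nat.cast_nonneg _) (S^[n] (y j))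
      rw [hWS n _ (hyY j), hWC _ (Nat.cast_nonneg _), ← Nat.cast_add, Nat.sub_add_cancel hnk.le] at h
      exact h.symm)
  have horb : ∀ t ≥ (0:ℝ), Cinv (W t (C x)) = W t x := by
    intro t ht
    rw [hWC t ht, hCinv]
  refine ⟨C x, ?_, ?_⟩
  · rw [hZ]
    refine ⟨fun t ht => ⟨W t x, (hWC t ht x).symm⟩, ?_⟩
    exact (hWcont x).congr fun t ht => horb t ht
  intro U hU hUne
  -- uniform boundedness on `[0,1]`
  obtain ⟨M, hM⟩ : ∃ M, ∀ s : Set.Icc (0:ℝ) 1, ‖W s‖ ≤ M := by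
    apply banach_steinhaus
    intro z
    obtain ⟨B, hB⟩ := isCompact_Icc.exists_bound_of_continuousOn
      ((hWcont z).mono (s := Set.Ici (0:ℝ)) (t := Set.Icc (0:ℝ) 1) (fun s hs => hs.1))
    exact ⟨B, fun s => hB s s.2⟩
  have hM0 : 0 ≤ M := (norm_nonneg _).trans (hM ⟨0, by simp⟩)
  -- pick a point of the dense sequence in the preimage of U
  obtain ⟨i, hi⟩ : ∃ i, (u i : X) ∈ C ⁻¹' U := by
    apply hu'.exists_mem_open (hU.preimage C.continuous)
    obtain ⟨z, hz⟩ := hCdense.exists_mem_open hU hUne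
    exact ⟨z, hz⟩
  obtain ⟨y0, hy0⟩ : ∃ y0 : X, y0 = (u i : X) := ⟨_, rfl⟩
  rw [← hy0] at hi
  obtain ⟨ε, hε, hball⟩ := Metric.isOpen_iff.1 hU (C y0) hi
  -- continuity of `W s y0` at `0`
  obtain ⟨δ, hδ, hδ1, hcont⟩ : ∃ δ : ℝ, 0 < δ ∧ δ ≤ 1 ∧ ∀ s, 0 ≤ s → s < δ →
      ‖W s y0 - C y0‖ < ε / 2 := by
    obtain ⟨δ, hδ, h⟩ := Metric.continuousWithinAt_iff.1 (hWcont y0 0 (by simp)) (ε / 2) (by linarith)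
    refine ⟨min δ 1, lt_min hδ one_pos, min_le_right _ _, fun s hs hsd => ?_⟩
    have := h (x := s) hs (by
      rw [Real.dist_eq, sub_zero, abs_of_nonneg hs]
      exact hsd.trans_le (min_le_left _ _))
    rwa [dist_eq_norm, hW0] at this
  -- choose a large level
  obtain ⟨l, hl, hlsmall⟩ : ∃ l, y l = y0 ∧ M * (4 * (1/2:ℝ)^l) < ε / 2 := by
    have ht : Tendsto (fun n : ℕ => M * (4 * (1/2:ℝ)^n)) atTop (𝓝 (M * (4 * 0))) :=
      ((tendsto_pow_atTop_nhds_zero_of_lt_one (by norm_num) (by norm_num)).const_mul 4).const_mul M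
    rw [mul_zero, mul_zero] at ht
    obtain ⟨n, hn⟩ := (ht.eventually (gt_mem_nhds (show (0:ℝ) < ε / 2 by linarith))).exists
    refine ⟨Nat.pair i n, by simp [hy, hy0], lt_of_le_of_lt ?_ hn⟩
    have : ((1:ℝ)/2)^(Nat.pair i n) ≤ (1/2)^n :=
      pow_le_pow_of_le_one (by norm_num) (by norm_num) (Nat.right_le_pair i n)
    gcongr
  have key : ∀ k ∈ A l, ∀ t : ℝ, (k : ℝ) ≤ t → t < k + δ → Cinv (W t (C x)) ∈ U := by
    intro k hk t hkt htk
    have hk0 : (0:ℝ) ≤ k := Nat.cast_nonneg k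
    rw [horb t (hk0.trans hkt)]
    obtain ⟨g, hg1, hg2⟩ := hx l k hk
    simp only [Function.iterate_zero, id] at hg1 hg2
    rw [hl] at hg2
    have hs0 : 0 ≤ t - k := by linarith
    have hWt : W t x = W (t - k) g := by
      apply hCinj
      have h := hWsg k hk0 (t - k) hs0 x
      rw [hg1, sub_add_cancel, hWC _ hs0] at h
      exact h.symm
    rw [hWt]
    apply hball
    rw [mem_ball_iff_norm]
    have e1 : W (t - k) g - C y0 = W (t - k) (g - y0) + (W (t - k) y0 - C y0) := by
      rw [map_sub]; abel
    have e2 : ‖W (t - k) (g - y0)‖ ≤ M * (4 * (1/2:ℝ)^l) :=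
      ((W (t - k)).le_opNorm _).trans
        (mul_le_mul (hM ⟨t - k, hs0, by linarith⟩) hg2 (norm_nonneg _) hM0)
    have e3 := hcont (t - k) hs0 (by linarith)
    rw [e1]
    refine (norm_add_le _ _).trans_lt ?_
    linarith
  constructor
  · exact (hA l).lowerDensityR_pos hδ hδ1 fun k hk t h1 h2 =>
      ⟨le_trans (Nat.cast_nonneg k) h1, key k hk t h1 h2⟩
  · exact (hA l).lowerDensity_pos fun k hk => key k hk k le_rfl (by linarith)
end
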